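/- arXiv:0903.1999 — 2 statements merged into one kernel-verified Lean document; each statement's English description precedes it below -/
import Mathlib

section
/- Let X be any finite set of permutations. Then the classes I₂ ∩ Av(X) and I₂ ∩ Av(red(X)) have the same growth rate: s(I₂ ∩ Av(X)) = s(I₂ ∩ Av(red(X))). -/
open Filter

/-- `f` is an embedding (involvement) of the permutation `α` into the permutation `π`:
it is strictly monotone on positions and preserves the relative order of values. -/
def IsEmbedding {m n : ℕ} (α : Equiv.Perm (Fin m)) (π : Equiv.Perm (Fin n))
    (f : Fin m → Fin n) : Prop :=
  StrictMono f ∧ ∀ a b : Fin m, α a < α b ↔ π (f a) < π (f b)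

/-- A permutation of arbitrary (finite) length. -/
abbrev PermSig := Σ n : ℕ, Equiv.Perm (Fin n)

/-- `α ≼ π`: the pattern `α` is involved in `π`. -/
def Involves (α π : PermSig) : Prop := ∃ f, IsEmbedding α.2 π.2 f

/-- The class of permutations avoiding every pattern in `X`. -/
def AvClass (X : Set PermSig) : Set PermSig := {π | ∀ α ∈ X, ¬ Involves α π}

/-- A pattern class: a set of permutations closed downward under involvement. -/
def IsPatternClass (C : Set PermSig) : Prop :=
  ∀ α π : PermSig, Involves α π → π ∈ C → α ∈ C

/-- The number of permutations of length `n` in `C`. -/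
noncomputable def classCount (C : Set PermSig) (n : ℕ) : ℕ :=
  Nat.card {π : Equiv.Perm (Fin n) // (⟨n, π⟩ : PermSig) ∈ C}

/-- The (upper) growth rate `s(C) = limsup |C ∩ S_n|^{1/n}`, valued in `ℝ≥0∞`. -/
noncomputable def growthRate (C : Set PermSig) : ENNReal :=
  Filter.atTop.limsup fun n : ℕ => (classCount C n : ENNReal) ^ (1 / (n : ℝ))

/-- `π` contains a decreasing subsequence of length `k`. -/
def HasDecSeq {n : ℕ} (π : Equiv.Perm (Fin n)) (k : ℕ) : Prop :=
  ∃ q : Fin k → Fin n, StrictMono q ∧ StrictAnti fun i => π (q i)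

/-- The class `I_k = Av(δ_{k+1})` of permutations with no decreasing
subsequence of length `k+1`. -/
def IkClass (k : ℕ) : Set PermSig := {π | ¬ HasDecSeq π.2 (k + 1)}

/-- `f` and `g` witness `π` as a merge of `α` and `β`: both are embeddings and
their ranges partition the points of `π`. -/
def IsMergeVia {a b n : ℕ} (α : Equiv.Perm (Fin a)) (β : Equiv.Perm (Fin b))
    (π : Equiv.Perm (Fin n)) (f : Fin a → Fin n) (g : Fin b → Fin n) : Prop :=
  IsEmbedding α π f ∧ IsEmbedding β π g ∧ ∀ x : Fin n, (∃ i, f i = x) ↔ ¬∃ j, g j = x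

/-- The merge `M(C, D)` of two sets of permutations. -/
def MergeClass (C D : Set PermSig) : Set PermSig :=
  {π | ∃ α ∈ C, ∃ β ∈ D, ∃ f g, IsMergeVia α.2 β.2 π.2 f g}

/-- Number of indices `c` with `c+1 < n` such that exactly one of the points
`c`, `c+1` lies in `S`. -/
noncomputable def posChanges {n : ℕ} (S : Set (Fin n)) : ℕ :=
  Set.ncard {c : Fin n | ∃ h : (c : ℕ) + 1 < n, ¬ (c ∈ S ↔ (⟨(c : ℕ) + 1, h⟩ : Fin n) ∈ S)}

/-- Total number of type changes, by position and by value, of the merge of `π`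
whose first part occupies the set of positions `S`. -/
noncomputable def typeChanges {n : ℕ} (π : Equiv.Perm (Fin n)) (S : Set (Fin n)) : ℕ :=
  posChanges S + posChanges ((fun x => π x) '' S)

/-- The `B`-bounded merge `M_B(C, D)`: merges of a member of `C` with a member of
`D` having at most `B` type changes in total, by position or by value. -/
def BMergeClass (B : ℕ) (C D : Set PermSig) : Set PermSig :=
  {π | ∃ α ∈ C, ∃ β ∈ D, ∃ f g, IsMergeVia α.2 β.2 π.2 f g ∧
    typeChanges π.2 (Set.range f) ≤ B}

/-- The direct sum of two permutations. -/
def dsum {a b : ℕ} (α : Equiv.Perm (Fin a)) (β : Equiv.Perm (Fin b)) :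
    Equiv.Perm (Fin (a + b)) :=
  finSumFinEquiv.symm.trans ((Equiv.sumCongr α β).trans finSumFinEquiv)

/-- The direct sum `α ⊕ β` of two permutations of arbitrary lengths. -/
def DSum (α β : PermSig) : PermSig := ⟨α.1 + β.1, dsum α.2 β.2⟩

/-- The increasing permutation `ι_m` of length `m`. -/
def iotaSig (m : ℕ) : PermSig := ⟨m, 1⟩

/-- The direct sum of a list of permutations. -/
def DSumList (l : List PermSig) : PermSig := l.foldr DSum (iotaSig 0)

/-- A (nonempty) permutation that is not the direct sum of two nonempty permutations. -/
def PlusIndec (ρ : PermSig) : Prop :=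
  ρ.1 ≠ 0 ∧ ∀ α β : PermSig, α.1 ≠ 0 → β.1 ≠ 0 → ρ ≠ DSum α β

/-- `ρ = red(π)`: writing `π = ι_{m₀} ⊕ ρ₁ ⊕ ι_{m₁} ⊕ ⋯ ⊕ ρ_c ⊕ ι_{m_c}` with each
`ρ_i` plus indecomposable of length at least 2, the rigid reduction of `π` is
`ρ = ρ₁ ⊕ ⋯ ⊕ ρ_c`. -/
def IsRigidReductionOf (ρ π : PermSig) : Prop :=
  ∃ (m₀ : ℕ) (pairs : List (PermSig × ℕ)),
    (∀ p ∈ pairs, PlusIndec p.1 ∧ 2 ≤ p.1.1) ∧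
    π = DSum (iotaSig m₀) (DSumList (pairs.map fun p => DSum p.1 (iotaSig p.2))) ∧
    ρ = DSumList (pairs.map Prod.fst)


section Geometry
variable {P : Type} 

def FConvex (f : P → ℤ) (S : Set P) : Prop :=
  ∀ x ∈ S, ∀ y ∈ S, ∀ z, f x ≤ f z → f z ≤ f y → z ∈ S

def Cov (f : P → ℤ) (K : ℕ) (C : Set P) : Prop :=
  ∃ l : List (Set P), l.length ≤ K ∧ (∀ s ∈ l, FConvex f s) ∧ ∀ z, z ∈ C ↔ ∃ s ∈ l, z ∈ s

lemma Cov.mono {f : P → ℤ} {K K' : ℕ} {C : Set P} (h : Cov f K C) (hK : K ≤ K') : Cov f K' C := by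
  obtain ⟨l, h1, h2, h3⟩ := h
  exact ⟨l, h1.trans hK, h2, h3⟩

lemma Cov.union {f : P → ℤ} {K K' : ℕ} {C C' : Set P} (h : Cov f K C) (h' : Cov f K' C') :
    Cov f (K + K') (C ∪ C') := by
  obtain ⟨l, h1, h2, h3⟩ := h
  obtain ⟨l', h1', h2', h3'⟩ := h'
  refine ⟨l ++ l', by simp; omega, ?_, ?_⟩
  · intro s hs
    rcases List.mem_append.1 hs with hs | hs
    · exact h2 s hs
    · exact h2' s hs
  · intro z
    rw [Set.mem_union, h3, h3']
    constructor
    · rintro (⟨s, hs, hz⟩ | ⟨s, hs, hz⟩)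
      · exact ⟨s, List.mem_append_left _ hs, hz⟩
      · exact ⟨s, List.mem_append_right _ hs, hz⟩
    · rintro ⟨s, hs, hz⟩
      rcases List.mem_append.1 hs with hs | hs
      · exact Or.inl ⟨s, hs, hz⟩
      · exact Or.inr ⟨s, hs, hz⟩

lemma Cov.of_convex {f : P → ℤ} {C : Set P} (h : FConvex f C) : Cov f 1 C :=
  ⟨[C], by simp, by simpa using h, by simp⟩

lemma Cov.empty (f : P → ℤ) : Cov f 0 (∅ : Set P) := ⟨[], by simp, by simp, by simp⟩

lemma Cov.neg {f : P → ℤ} {K : ℕ} {C : Set P} (h : Cov (fun z => - f z) K C) : Cov f K C := by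
  obtain ⟨l, h1, h2, h3⟩ := h
  refine ⟨l, h1, ?_, h3⟩
  intro s hs x hx y hy z hxz hzy
  exact h2 s hs y hy x hx z (by simpa using hzy) (by simpa using hxz)

lemma Cov.of_finset {f : P → ℤ} (hf : Function.Injective f) (S : Finset P) :
    Cov f S.card (S : Set P) := by
  classical
  induction S using Finset.induction_on with
  | empty => simpa using Cov.empty f
  | insert a S ha ih =>
    rw [Finset.card_insert_of_notMem ha, Finset.coe_insert, Set.insert_eq, add_comm]
    refine Cov.union (Cov.of_convex ?_) ih
    intro x hx y hy z hxz hzy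
    rw [Set.mem_singleton_iff] at *
    subst hx; subst hy
    exact hf (le_antisymm hzy hxz)

def hull (f : P → ℤ) (T : Set P) : Set P := {z | ∃ x ∈ T, ∃ y ∈ T, f x ≤ f z ∧ f z ≤ f y}

lemma hull_convex (f : P → ℤ) (T : Set P) : FConvex f (hull f T) := by
  rintro x ⟨a, ha, b, hb, h1, h2⟩ y ⟨c, hc, d, hd, h3, h4⟩ z hxz hzy
  exact ⟨a, ha, d, hd, h1.trans hxz, hzy.trans h4⟩

lemma subset_hull (f : P → ℤ) (T : Set P) : T ⊆ hull f T := fun x hx => ⟨x, hx, x, hx, le_rfl, le_rfl⟩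

/-- zigzag sequence -/
def zig (f g : P → ℤ) (U T₀ : Set P) : ℕ → Set P
  | 0 => T₀
  | k + 1 => if Even k then Uᶜ ∩ hull f (zig f g U T₀ k) else U ∩ hull g (zig f g U T₀ k)

def Mono2 (f g : P → ℤ) (U : Set P) : Prop := ∀ x ∈ U, ∀ y ∈ U, f x ≤ f y ↔ g x ≤ g y

def zigF (f g : P → ℤ) (U T₀ : Set P) (k : ℕ) : Set P := {z | ∃ i, 1 ≤ i ∧ i ≤ k ∧ z ∈ zig f g U T₀ i}

variable {f g : P → ℤ} {U T₀ : Set P}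

lemma zig_odd (j : ℕ) : zig f g U T₀ (2*j+1) = Uᶜ ∩ hull f (zig f g U T₀ (2*j)) := by
  rw [zig, if_pos (by simp)]

lemma zig_even (j : ℕ) : zig f g U T₀ (2*j+2) = U ∩ hull g (zig f g U T₀ (2*j+1)) := by
  rw [zig, if_neg (by simp)]

lemma zig_even_sub (hT : T₀ ⊆ U) (j : ℕ) : zig f g U T₀ (2*j) ⊆ U := by
  cases j with
  | zero => exact hT
  | succ j => rw [show 2*(j+1) = 2*j+2 by ring, zig_even]; exact Set.inter_subset_left

lemma hull_even (hU : Mono2 f g U) (hT : T₀ ⊆ U)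
    (hT2 : ∀ x ∈ T₀, ∀ y ∈ T₀, ∀ z ∈ U, f x ≤ f z → f z ≤ f y → z ∈ T₀) (j : ℕ) :
    hull f (zig f g U T₀ (2*j)) = zig f g U T₀ (2*j) ∪ zig f g U T₀ (2*j+1) := by
  apply Set.Subset.antisymm
  · intro z hz
    by_cases hzU : z ∈ U
    · left
      obtain ⟨x, hx, y, hy, h1, h2⟩ := hz
      cases j with
      | zero => exact hT2 x hx y hy z hzU h1 h2
      | succ j =>
        have hxU := zig_even_sub hT _ hx
        have hyU := zig_even_sub hT _ hy
        rw [show 2*(j+1) = 2*j+2 by ring, zig_even] at *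
        refine ⟨hzU, hull_convex g _ x hx.2 y hy.2 z ?_ ?_⟩
        · exact (hU x hxU z hzU).1 h1
        · exact (hU z hzU y hyU).1 h2
    · right
      rw [zig_odd]; exact ⟨hzU, hz⟩
  · apply Set.union_subset (subset_hull _ _)
    rw [zig_odd]; exact Set.inter_subset_right

lemma hull_odd (hL : Mono2 f g Uᶜ) (j : ℕ) :
    hull g (zig f g U T₀ (2*j+1)) = zig f g U T₀ (2*j+1) ∪ zig f g U T₀ (2*j+2) := by
  apply Set.Subset.antisymm
  · intro z hz
    by_cases hzU : z ∈ U
    · right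
      rw [zig_even]; exact ⟨hzU, hz⟩
    · left
      obtain ⟨x, hx, y, hy, h1, h2⟩ := hz
      rw [zig_odd] at *
      refine ⟨hzU, hull_convex f _ x hx.2 y hy.2 z ?_ ?_⟩
      · exact (hL x hx.1 z hzU).2 h1
      · exact (hL z hzU y hy.1).2 h2
  · apply Set.union_subset (subset_hull _ _)
    rw [zig_even]; exact Set.inter_subset_right

lemma zigF_succ (k : ℕ) : zigF f g U T₀ (k+1) = zigF f g U T₀ k ∪ zig f g U T₀ (k+1) := by
  ext z
  simp only [zigF, Set.mem_setOf_eq, Set.mem_union]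
  constructor
  · rintro ⟨i, h1, h2, h3⟩
    rcases Nat.lt_or_ge i (k+1) with h | h
    · exact Or.inl ⟨i, h1, by omega, h3⟩
    · have : i = k+1 := by omega
      subst this; exact Or.inr h3
  · rintro (⟨i, h1, h2, h3⟩ | h)
    · exact ⟨i, h1, by omega, h3⟩
    · exact ⟨k+1, by omega, le_rfl, h⟩

lemma zigF_zero : zigF f g U T₀ 0 = ∅ := by
  ext z
  simp only [zigF, Set.mem_setOf_eq, Set.mem_empty_iff_false, iff_false]
  rintro ⟨i, h1, h2, _⟩; omega

lemma cov_f_zigF (hU : Mono2 f g U) (hT : T₀ ⊆ U)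
    (hT2 : ∀ x ∈ T₀, ∀ y ∈ T₀, ∀ z ∈ U, f x ≤ f z → f z ≤ f y → z ∈ T₀) (j : ℕ) :
    Cov f (j+1) (T₀ ∪ zigF f g U T₀ (2*j+1)) := by
  induction j with
  | zero =>
    have := hull_even hU hT hT2 0
    have h2 : T₀ ∪ zigF f g U T₀ (2*0+1) = hull f T₀ := by
      rw [zigF_succ, zigF_zero, Set.empty_union]; exact this.symm
    rw [h2]; exact Cov.of_convex (hull_convex _ _)
  | succ j ih =>
    have h := ih.union (Cov.of_convex (hull_convex f (zig f g U T₀ (2*(j+1)))))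
    rw [hull_even hU hT hT2] at h
    have : T₀ ∪ zigF f g U T₀ (2*(j+1)+1) = T₀ ∪ zigF f g U T₀ (2 * j + 1) ∪ (zig f g U T₀ (2 * (j + 1)) ∪ zig f g U T₀ (2 * (j + 1) + 1)) := by
      rw [zigF_succ, show 2*(j+1) = 2*j+1+1 by ring, zigF_succ]
      simp only [Set.union_assoc]
    rw [this]; exact h

lemma cov_g_zigF (hL : Mono2 f g Uᶜ) (j : ℕ) :
    Cov g j (zigF f g U T₀ (2*j)) := by
  induction j with
  | zero => simp only [mul_zero]; rw [zigF_zero]; exact Cov.empty _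
  | succ j ih =>
    have h := ih.union (Cov.of_convex (hull_convex g (zig f g U T₀ (2*j+1))))
    rw [hull_odd hL] at h
    rw [show 2*(j+1) = 2*j+1+1 by ring, zigF_succ, zigF_succ, Set.union_assoc]
    exact h

lemma zigF_sub (hT : T₀ ⊆ U) (Inv : Set P)
    (h0 : ∀ z ∉ U, z ∈ hull f T₀ → z ∈ Inv)
    (h1 : ∀ x ∈ Inv, x ∉ U → ∀ y ∈ Inv, y ∉ U → ∀ z ∈ U, g x ≤ g z → g z ≤ g y → z ∈ Inv)
    (h2 : ∀ x ∈ Inv, x ∈ U → ∀ y ∈ Inv, y ∈ U → ∀ z ∉ U, f x ≤ f z → f z ≤ f y → z ∈ Inv)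
    (k : ℕ) : zigF f g U T₀ k ⊆ Inv := by
  have key : ∀ j, zig f g U T₀ (2*j+1) ⊆ Inv ∧ zig f g U T₀ (2*j+2) ⊆ Inv := by
    have step : ∀ j, zig f g U T₀ (2*j+1) ⊆ Inv → zig f g U T₀ (2*j+2) ⊆ Inv := by
      intro j h z hz
      rw [zig_even] at hz
      obtain ⟨hzU, x, hx, y, hy, h3, h4⟩ := hz
      have hx' := hx; have hy' := hy
      rw [zig_odd] at hx' hy'
      exact h1 x (h hx) hx'.1 y (h hy) hy'.1 z hzU h3 h4
    intro j
    induction j with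
    | zero =>
      have : zig f g U T₀ (2*0+1) ⊆ Inv := by
        intro z hz
        rw [zig_odd] at hz
        exact h0 z hz.1 hz.2
      exact ⟨this, step 0 this⟩
    | succ j ih =>
      have : zig f g U T₀ (2*(j+1)+1) ⊆ Inv := by
        intro z hz
        rw [zig_odd] at hz
        obtain ⟨hzU, x, hx, y, hy, h3, h4⟩ := hz
        exact h2 x (ih.2 hx) (zig_even_sub hT _ hx) y (ih.2 hy) (zig_even_sub hT _ hy) z hzU h3 h4
      exact ⟨this, step _ this⟩
  rintro z ⟨i, hi1, hi2, hz⟩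
  rcases Nat.even_or_odd' i with ⟨j, rfl | rfl⟩
  · obtain ⟨j, rfl⟩ : ∃ j', j = j' + 1 := ⟨j - 1, by omega⟩
    exact (key j).2 hz
  · exact (key j).1 hz

lemma oneSided [Fintype P] (hg : Function.Injective g) (hU : Mono2 f g U) (hL : Mono2 f g Uᶜ) (hT : T₀ ⊆ U)
    (hT2 : ∀ x ∈ T₀, ∀ y ∈ T₀, ∀ z ∈ U, f x ≤ f z → f z ≤ f y → z ∈ T₀)
    (Inv : Set P)
    (h0 : ∀ z ∉ U, z ∈ hull f T₀ → z ∈ Inv)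
    (h1 : ∀ x ∈ Inv, x ∉ U → ∀ y ∈ Inv, y ∉ U → ∀ z ∈ U, g x ≤ g z → g z ≤ g y → z ∈ Inv)
    (h2 : ∀ x ∈ Inv, x ∈ U → ∀ y ∈ Inv, y ∈ U → ∀ z ∉ U, f x ≤ f z → f z ≤ f y → z ∈ Inv)
    (D : ℕ) (hD : Fintype.card P < D * D) :
    ∃ C : Set P, C ⊆ Inv ∧ Cov f D (T₀ ∪ C) ∧ Cov g (2*D) C := by
  classical
  have hpos : 0 < D := by
    rcases Nat.eq_zero_or_pos D with h | h
    · subst h; simp at hD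
    · exact h
  set F : ℕ → Finset P := fun k => (zigF f g U T₀ k).toFinset with hF
  have hmono : ∀ k, F k ⊆ F (k+1) := by
    intro k z hz
    simp only [hF, Set.mem_toFinset] at *
    rw [zigF_succ]; exact Or.inl hz
  have hsum : ∀ m, ∑ j ∈ Finset.range m, (F (2*j+1) \ F (2*j)).card ≤ (F (2*m)).card := by
    intro m
    induction m with
    | zero => simp
    | succ m ih =>
      rw [Finset.sum_range_succ]
      have e1 : (F (2*m+1) \ F (2*m)).card + (F (2*m)).card = (F (2*m+1)).card :=
        Finset.card_sdiff_add_card_eq_card (hmono _)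
      have e2 : (F (2*m+1)).card ≤ (F (2*(m+1))).card := Finset.card_le_card (hmono _)
      omega
  obtain ⟨j, hj, hjD⟩ : ∃ j ∈ Finset.range D, (F (2*j+1) \ F (2*j)).card < D := by
    by_contra hcon
    push Not at hcon
    have := Finset.card_nsmul_le_sum (Finset.range D) (fun j => (F (2*j+1) \ F (2*j)).card) D hcon
    have h3 := hsum D
    have h4 := Finset.card_le_univ (F (2*D))
    simp only [Finset.card_range, smul_eq_mul] at this
    omega
  rw [Finset.mem_range] at hj
  refine ⟨zigF f g U T₀ (2*j+1), zigF_sub hT Inv h0 h1 h2 _, (cov_f_zigF hU hT hT2 j).mono hj, ?_⟩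
  have h5 := (cov_g_zigF (T₀ := T₀) hL j).union (Cov.of_finset hg (F (2*j+1) \ F (2*j)))
  have : zigF f g U T₀ (2*j) ∪ ((F (2*j+1) \ F (2*j) : Finset P) : Set P) = zigF f g U T₀ (2*j+1) := by
    ext z
    have := @hmono (2*j) z
    simp only [hF, Set.mem_toFinset] at this
    simp only [hF, Set.mem_union, Finset.coe_sdiff, Set.coe_toFinset, Set.mem_diff]
    tauto
  rw [this] at h5
  exact h5.mono (by omega)

end Geometry

section Part1b
variable {P : Type} {f g : P → ℤ} {U : Set P}

/-- inversions go from `U` to the complement -/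
def UL (f g : P → ℤ) (U : Set P) : Prop := ∀ x y, f x < f y → g y < g x → x ∈ U ∧ y ∉ U

lemma UL.monoU (hf : Function.Injective f) (hg : Function.Injective g) (h : UL f g U) : Mono2 f g U := by
  have key : ∀ x ∈ U, ∀ y ∈ U, f x ≤ f y → g x ≤ g y := by
    intro x hx y hy hxy
    by_contra hc
    push Not at hc
    rcases hxy.lt_or_eq with h1 | h1
    · exact (h x y h1 hc).2 hy
    · rw [hf h1] at hc; exact lt_irrefl _ hc
  intro x hx y hy
  refine ⟨key x hx y hy, fun h1 => ?_⟩
  by_contra hc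
  push Not at hc
  have := key y hy x hx hc.le
  rw [hg (le_antisymm h1 this)] at hc
  exact lt_irrefl _ hc

lemma UL.monoL (hf : Function.Injective f) (hg : Function.Injective g) (h : UL f g U) : Mono2 f g Uᶜ := by
  have key : ∀ x ∈ Uᶜ, ∀ y ∈ Uᶜ, f x ≤ f y → g x ≤ g y := by
    intro x hx y hy hxy
    by_contra hc
    push Not at hc
    rcases hxy.lt_or_eq with h1 | h1
    · exact hx (h x y h1 hc).1
    · rw [hf h1] at hc; exact lt_irrefl _ hc
  intro x hx y hy
  refine ⟨key x hx y hy, fun h1 => ?_⟩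
  by_contra hc
  push Not at hc
  have := key y hy x hx hc.le
  rw [hg (le_antisymm h1 this)] at hc
  exact lt_irrefl _ hc

lemma exists_UL (hg : Function.Injective g)
    (h321 : ∀ x y z, f x < f y → f y < f z → g y < g x → g z < g y → False) :
    UL f g {z | ∀ y, f y < f z → g y < g z} := by
  intro x y hxy hyx
  constructor
  · intro w hw
    by_contra hc
    push Not at hc
    rcases hc.lt_or_eq with h1 | h1
    · exact h321 w x y hw hxy h1 hyx
    · rw [hg h1] at hw; exact absurd hw (lt_irrefl _)
  · intro h
    have := h x hxy
    omega

/-- what the upward closure of the strip satisfies -/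
def UpInv (f g : P → ℤ) (U V : Set P) : Set P :=
  {z | (z ∈ U → ∃ l ∉ U, l ∈ V ∧ f l ≤ f z) ∧
    (z ∉ U → ∃ u ∈ U, ∃ l ∉ U, l ∈ V ∧ f l ≤ f u ∧ g u ≤ g z)}

lemma stripUp [Fintype P] (hf : Function.Injective f) (hg : Function.Injective g) (h : UL f g U)
    (V : Set P) (hV : FConvex g V) (D : ℕ) (hD : Fintype.card P < D * D) :
    ∃ C ⊆ UpInv f g U V, Cov f D (Uᶜ ∩ V ∪ C) ∧ Cov g (2 * D) C := by
  have hU := h.monoU hf hg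
  have hL := h.monoL hf hg
  refine oneSided (U := Uᶜ) (T₀ := Uᶜ ∩ V) hg hL (by rwa [compl_compl]) Set.inter_subset_left
    ?_ (UpInv f g U V) ?_ ?_ ?_ D hD
  · rintro x ⟨hx, hxV⟩ y ⟨hy, hyV⟩ z hz h1 h2
    exact ⟨hz, hV x hxV y hyV z ((hL x hx z hz).1 h1) ((hL z hz y hy).1 h2)⟩
  · rintro z hz ⟨x, ⟨hx, hxV⟩, y, ⟨hy, hyV⟩, h1, h2⟩
    exact ⟨fun _ => ⟨x, hx, hxV, h1⟩, fun hz' => absurd hz' hz⟩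
  · intro x hx hxU y hy hyU z hz h1 h2
    refine ⟨fun hz' => absurd hz' hz, fun _ => ?_⟩
    have hxU : x ∈ U := not_not.1 hxU
    obtain ⟨l, hl, hlV, hlx⟩ := hx.1 hxU
    exact ⟨x, hxU, l, hl, hlV, hlx, h1⟩
  · intro x hx hxU y hy hyU z hz h1 h2
    have hzU : z ∈ U := not_not.1 hz
    refine ⟨fun _ => ?_, fun hz' => absurd hz' hz⟩
    obtain ⟨u, hu, l, hl, hlV, hlu, hux⟩ := hx.2 hxU
    refine ⟨l, hl, hlV, ?_⟩
    by_contra hc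
    push Not at hc
    have hne : g u ≠ g x := fun he => hxU (hg he ▸ hu)
    exact hxU (h x u (by omega) (by omega)).1

lemma stripDown [Fintype P] (hf : Function.Injective f) (hg : Function.Injective g) (h : UL f g U)
    (V : Set P) (hV : FConvex g V) (b : P) (hb : b ∉ U)
    (hbV : ∀ u ∈ U, (u ∈ V ∨ g u < g b) → f u < f b) (D : ℕ) (hD : Fintype.card P < D * D) :
    ∃ C ⊆ {z | g z < g b}, Cov f D (U ∩ V ∪ C) ∧ Cov g (2 * D) C := by
  have hU := h.monoU hf hg
  have hL := h.monoL hf hg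
  have hLb : ∀ z ∉ U, f z < f b → g z < g b := by
    intro z hz hzb
    by_contra hc
    push Not at hc
    have := (hL b hb z hz).2 hc
    omega
  refine oneSided (U := U) (T₀ := U ∩ V) hg hU hL Set.inter_subset_left
    ?_ {z | g z < g b} ?_ ?_ ?_ D hD
  · rintro x ⟨hx, hxV⟩ y ⟨hy, hyV⟩ z hz h1 h2
    exact ⟨hz, hV x hxV y hyV z ((hU x hx z hz).1 h1) ((hU z hz y hy).1 h2)⟩
  · rintro z hz ⟨x, ⟨hx, hxV⟩, y, ⟨hy, hyV⟩, h1, h2⟩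
    have := hbV y hy (Or.inl hyV)
    exact hLb z hz (by omega)
  · intro x hx hxU y hy hyU z hz h1 h2
    exact lt_of_le_of_lt h2 hy
  · intro x hx hxU y hy hyU z hz h1 h2
    have := hbV y hyU (Or.inr hy)
    exact hLb z hz (by omega)

lemma strip [Fintype P] (hf : Function.Injective f) (hg : Function.Injective g) (h : UL f g U)
    (V : Set P) (hV : FConvex g V) (b : P) (hb : b ∉ U)
    (hbV : ∀ u ∈ U, (u ∈ V ∨ g u < g b) → f u < f b) (D : ℕ) (hD : Fintype.card P < D * D) :
    ∃ C, V ⊆ C ∧ Cov f (5 * D) C ∧ Cov g (5 * D) C ∧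
      ∀ z ∈ C, z ∈ V ∨ g z < g b ∨ z ∈ UpInv f g U V := by
  obtain ⟨C1, h1, h2, h3⟩ := stripDown hf hg h V hV b hb hbV D hD
  obtain ⟨C2, k1, k2, k3⟩ := stripUp hf hg h V hV D hD
  have hD1 : 1 ≤ D := by
    rcases Nat.eq_zero_or_pos D with h0 | h0
    · subst h0; simp at hD
    · exact h0
  refine ⟨V ∪ (C1 ∪ C2), Set.subset_union_left, ?_, ?_, ?_⟩
  · have := (h2.union k2).mono (K' := 5 * D) (by omega)
    convert this using 1
    ext z
    simp only [Set.mem_union, Set.mem_inter_iff, Set.mem_compl_iff]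
    tauto
  · exact ((Cov.of_convex hV).union (h3.union k3)).mono (by omega)
  · rintro z (hz | hz | hz)
    · exact Or.inl hz
    · exact Or.inr (Or.inl (h1 hz))
    · exact Or.inr (Or.inr (k1 hz))

end Part1b

section Part1c
variable {P : Type} {f g : P → ℤ} {U : Set P}

lemma Mono2.lt {f g : P → ℤ} {U : Set P} (h : Mono2 f g U) {x y : P} (hx : x ∈ U) (hy : y ∈ U) :
    f x < f y ↔ g x < g y := by
  have := h y hy x hx
  constructor <;> intro h1 <;> by_contra hc <;> push Not at hc
  · have := this.2 hc; omega
  · have := this.1 hc; omega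

/-- all of `S` is below and to the left of all of `T` -/
def SBelow (f g : P → ℤ) (S T : Set P) : Prop := ∀ x ∈ S, ∀ y ∈ T, f x < f y ∧ g x < g y

def No321 (f g : P → ℤ) : Prop :=
  ∀ x y z, f x < f y → f y < f z → g y < g x → g z < g y → False

def NoMid (f g : P → ℤ) (A B : Set (Set P)) : Prop :=
  ∀ x, ∀ S ∈ A, ∀ T ∈ B, SBelow f g S {x} → SBelow f g {x} T → False

def Good (f g : P → ℤ) (A B : Set (Set P)) (D : ℕ) : Prop :=
  ∃ Δ : Finset P, Δ.card ≤ 2 ∧ ∃ C : Set P, Cov f (5 * D) C ∧ Cov g (5 * D) C ∧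
    ∀ S ∈ A, ∀ T ∈ B, SBelow f g S T → (∀ d ∈ Δ, d ∉ S ∧ d ∉ T) →
      (∃ p, (p ∈ S ∨ p ∈ T) ∧ p ∈ C) ∧ (∃ q, (q ∈ S ∨ q ∈ T) ∧ q ∉ C)

variable {A B : Set (Set P)} {D : ℕ}

lemma Good.swap (h : Good g f A B D) : Good f g A B D := by
  obtain ⟨Δ, h1, C, h2, h3, h4⟩ := h
  exact ⟨Δ, h1, C, h3, h2, fun S hS T hT hST hd =>
    h4 S hS T hT (fun x hx y hy => (hST x hx y hy).symm) hd⟩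

lemma Good.neg (h : Good (fun z => - f z) (fun z => - g z) B A D) : Good f g A B D := by
  obtain ⟨Δ, h1, C, h2, h3, h4⟩ := h
  refine ⟨Δ, h1, C, h2.neg, h3.neg, fun S hS T hT hST hd => ?_⟩
  have := h4 T hT S hS (fun x hx y hy => by have := hST y hy x hx; simpa using this)
    (fun d hd' => (hd d hd').symm)
  obtain ⟨⟨p, hp, hp'⟩, ⟨q, hq, hq'⟩⟩ := this
  exact ⟨⟨p, hp.symm, hp'⟩, ⟨q, hq.symm, hq'⟩⟩

lemma good_emptyLeft [Fintype P] [Nonempty P] (hf : Function.Injective f) (hg : Function.Injective g)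
    (h321 : No321 f g) (hmid : NoMid f g A B) (hA : ∅ ∈ A) (hD : Fintype.card P < D * D) :
    Good f g A B D := by
  classical
  have hD1 : 1 ≤ D := by
    rcases Nat.eq_zero_or_pos D with h0 | h0
    · subst h0; simp at hD
    · exact h0
  obtain ⟨f0, hf0⟩ := Finite.exists_min f
  obtain ⟨a0, ha0⟩ := Finite.exists_min g
  have hUL := exists_UL hg h321
  set U : Set P := {z | ∀ y, f y < f z → g y < g z} with hUdef
  set V : Set P := {z | g z < g f0} with hVdef
  have hVL : V ⊆ Uᶜ := by
    intro z hz
    have hz' : g z < g f0 := hz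
    have h1 : f f0 ≠ f z := fun h => by rw [hf h] at hz'; exact lt_irrefl _ hz'
    exact (hUL f0 z (lt_of_le_of_ne (hf0 z) h1) hz).2
  have hVc : FConvex g V := by
    intro x hx y hy z h1 h2
    exact lt_of_le_of_lt h2 hy
  obtain ⟨C, k1, k2, k3⟩ := stripUp hf hg hUL V hVc D hD
  rw [Set.inter_eq_right.2 hVL] at k2
  refine ⟨{f0, a0}, Finset.card_le_two, V ∪ C, k2.mono (by omega),
    ((Cov.of_convex hVc).union k3).mono (by omega), ?_⟩
  intro S hS T hT hST hd
  have hmid' : ∀ x, ∃ y ∈ T, ¬ (f x < f y ∧ g x < g y) := by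
    intro x
    by_contra hc
    push Not at hc
    refine hmid x ∅ hA T hT (fun y hy => absurd hy (Set.notMem_empty _)) ?_
    rintro w hw y hy
    rw [Set.mem_singleton_iff] at hw
    subst hw
    exact hc y hy
  have hf0T : f0 ∉ T := (hd f0 (by simp)).2
  have ha0T : a0 ∉ T := (hd a0 (by simp)).2
  constructor
  · obtain ⟨y, hy, hy2⟩ := hmid' f0
    refine ⟨y, Or.inr hy, Or.inl ?_⟩
    have h1 := hf0 y
    have h2 : f f0 ≠ f y := fun h => hf0T (hf h ▸ hy)
    have h3 : g f0 ≠ g y := fun h => hf0T (hg h ▸ hy)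
    show g y < g f0
    omega
  · obtain ⟨y, hy, hy2⟩ := hmid' a0
    refine ⟨y, Or.inr hy, ?_⟩
    have h1 := ha0 y
    have h2 : f a0 ≠ f y := fun h => ha0T (hf h ▸ hy)
    have h3 : g a0 ≠ g y := fun h => ha0T (hg h ▸ hy)
    have h4 : f y < f a0 := by omega
    obtain ⟨hyU, ha0U⟩ := hUL y a0 h4 (by omega)
    rintro (hyV | hyC)
    · exact hVL hyV hyU
    · obtain ⟨l, hl, hlV, hly⟩ := (k1 hyC).1 hyU
      have := ((hUL.monoL hf hg).lt (x := l) (y := a0) hl ha0U).1 (by omega)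
      have := ha0 l
      omega

lemma good_V [Fintype P] (hf : Function.Injective f) (hg : Function.Injective g)
    (h321 : No321 f g) (hA0 : ∅ ∉ A) (hB0 : ∅ ∉ B) (A' B' : Set P)
    (hA' : ∀ x, x ∈ A' ↔ ∃ S ∈ A, SBelow f g S {x})
    (hB' : ∀ x, x ∈ B' ↔ ∃ T ∈ B, SBelow f g {x} T)
    (hV : ∀ a ∈ A', ∀ b ∈ B', g b < g a)
    (hD : Fintype.card P < D * D) :
    Good f g A B D := by
  classical
  have hD1 : 1 ≤ D := by
    rcases Nat.eq_zero_or_pos D with h0 | h0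
    · subst h0; simp at hD
    · exact h0
  have hSB : ∀ S ∈ A, ∀ T ∈ B, SBelow f g S T → S ⊆ B' := by
    intro S hS T hT hST x hx
    exact (hB' x).2 ⟨T, hT, fun w hw y hy => by rw [Set.mem_singleton_iff.1 hw]; exact hST x hx y hy⟩
  have hTA : ∀ S ∈ A, ∀ T ∈ B, SBelow f g S T → T ⊆ A' := by
    intro S hS T hT hST x hx
    exact (hA' x).2 ⟨S, hS, fun w hw y hy => by rw [Set.mem_singleton_iff.1 hy]; exact hST w hw x hx⟩
  have hSne : ∀ S ∈ A, S.Nonempty := fun S hS =>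
    Set.nonempty_iff_ne_empty.2 (fun h => hA0 (h ▸ hS))
  have hTne : ∀ S ∈ B, S.Nonempty := fun S hS =>
    Set.nonempty_iff_ne_empty.2 (fun h => hB0 (h ▸ hS))
  by_cases hBne : B'.Nonempty
  swap
  · refine ⟨∅, by simp, ∅, (Cov.empty f).mono (by omega), (Cov.empty g).mono (by omega), ?_⟩
    intro S hS T hT hST
    exact absurd ((hSne S hS).mono (hSB S hS T hT hST)) hBne
  obtain ⟨b0, hb0, hb0max⟩ := Set.exists_max_image B' g (Set.toFinite _) hBne
  by_cases hinv : ∃ a b, f a < f b ∧ g b < g a ∧ a ∉ B' ∧ b ∉ A'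
  · obtain ⟨a, b, hab, hba, haB, hbA⟩ := hinv
    have hUL := exists_UL hg h321
    set U : Set P := {z | ∀ y, f y < f z → g y < g z} with hUdef
    have hU := hUL.monoU hf hg
    have hL := hUL.monoL hf hg
    obtain ⟨haU, hbU⟩ := hUL a b hab hba
    have hha : g b0 < g a := by
      by_contra hc
      push Not at hc
      have h1 : g a ≠ g b0 := fun h => haB (hg h ▸ hb0)
      have h2 : f a ≠ f b0 := fun h => haB (hf h ▸ hb0)
      obtain ⟨T, hT, hT2⟩ := (hB' b0).1 hb0
      rcases lt_or_gt_of_ne h2 with h3 | h3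
      · refine haB ((hB' a).2 ⟨T, hT, ?_⟩)
        rintro w hw y hy
        rw [Set.mem_singleton_iff.1 hw]
        have := hT2 b0 rfl y hy
        omega
      · exact h321 b0 a b h3 hab (by omega) hba
    set V : Set P := {z | g b < g z ∧ g z ≤ g b0} with hVdef
    have hVc : FConvex g V := by
      intro x hx y hy z h1 h2
      exact ⟨lt_of_lt_of_le hx.1 h1, h2.trans hy.2⟩
    obtain ⟨C, hVC, c1, c2, c3⟩ := strip hf hg hUL V hVc b hbU (by
      intro u hu hu2
      have h1 : g u < g a := by
        rcases hu2 with hu2 | hu2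
        · have := hu2.2; omega
        · omega
      have := (hU.lt hu haU).2 h1
      omega) D hD
    refine ⟨{b}, by simp, C, c1, c2, ?_⟩
    intro S hS T hT hST hd
    have hb : b ∉ S ∧ b ∉ T := hd b (by simp)
    have hx : ∃ x ∈ S, x ∈ V := by
      have : ∃ x ∈ S, ¬ (f x < f b ∧ g x < g b) := by
        by_contra hc
        push Not at hc
        refine hbA ((hA' b).2 ⟨S, hS, ?_⟩)
        rintro w hw y hy
        rw [Set.mem_singleton_iff.1 hy]
        exact hc w hw
      obtain ⟨x, hx, hx2⟩ := this
      refine ⟨x, hx, ?_, hb0max x (hSB S hS T hT hST hx)⟩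
      have h1 : g b ≠ g x := fun h => hb.1 (hg h ▸ hx)
      have h2 : f b ≠ f x := fun h => hb.1 (hf h ▸ hx)
      by_contra hc
      exact h321 a b x hab (by omega) hba (by omega)
    obtain ⟨x, hx, hxV⟩ := hx
    refine ⟨⟨x, Or.inl hx, hVC hxV⟩, ?_⟩
    have hy : ∃ y ∈ T, g b0 < g y ∧ g y ≤ g a := by
      have : ∃ y ∈ T, ¬ (f a < f y ∧ g a < g y) := by
        by_contra hc
        push Not at hc
        refine haB ((hB' a).2 ⟨T, hT, ?_⟩)
        rintro w hw y hy
        rw [Set.mem_singleton_iff.1 hw]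
        exact hc y hy
      obtain ⟨y, hy, hy2⟩ := this
      refine ⟨y, hy, hV y (hTA S hS T hT hST hy) b0 hb0, ?_⟩
      by_contra hc
      push Not at hc
      have h2 : f a ≠ f y := fun h => by rw [hf h] at hc; exact lt_irrefl _ hc
      exact h321 y a b (by omega) hab hc hba
    obtain ⟨y, hy, hy1, hy2⟩ := hy
    refine ⟨y, Or.inr hy, fun hyC => ?_⟩
    have hxV1 := hxV.1
    have hxV2 := hxV.2
    rcases c3 y hyC with h | h | h
    · have := h.2; omega
    · omega
    · by_cases hyU : y ∈ U
      · obtain ⟨l, hl, hlV, hly⟩ := h.1 hyU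
        have := (hL.lt hbU hl).2 hlV.1
        have := (hU.lt haU hyU).1 (by omega)
        omega
      · obtain ⟨u, hu, l, hl, hlV, hlu, huy⟩ := h.2 hyU
        have := (hL.lt hbU hl).2 hlV.1
        have := (hU.lt haU hu).1 (by omega)
        omega
  · push Not at hinv
    refine ⟨∅, by simp, {z | g z ≤ g b0}, (Cov.of_convex ?_).mono (by omega),
      (Cov.of_convex ?_).mono (by omega), ?_⟩
    · intro x hx y hy z h1 h2
      by_contra hc
      have hc : g b0 < g z := not_le.1 hc
      have hy : g y ≤ g b0 := hy
      have h3 : f z ≠ f y := fun h => by rw [hf h] at hc; omega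
      have hzB : z ∉ B' := fun h => by have := hb0max z h; omega
      have := hV y (hinv z y (by omega) (by omega) hzB) b0 hb0
      omega
    · intro x hx y hy z h1 h2
      exact h2.trans hy
    · intro S hS T hT hST _
      obtain ⟨x, hx⟩ := hSne S hS
      obtain ⟨y, hy⟩ := hTne T hT
      refine ⟨⟨x, Or.inl hx, hb0max x (hSB S hS T hT hST hx)⟩, ⟨y, Or.inr hy, ?_⟩⟩
      exact not_le.2 (hV y (hTA S hS T hT hST hy) b0 hb0)

lemma good_iv [Fintype P] (hf : Function.Injective f) (hg : Function.Injective g)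
    (h321 : No321 f g) (hmid : NoMid f g A B) (A' B' : Set P)
    (hA' : ∀ x, x ∈ A' ↔ ∃ S ∈ A, SBelow f g S {x})
    (hB' : ∀ x, x ∈ B' ↔ ∃ T ∈ B, SBelow f g {x} T)
    (hV : ¬ ∀ a ∈ A', ∀ b ∈ B', g b < g a) (hH : ¬ ∀ a ∈ A', ∀ b ∈ B', f b < f a)
    (hD : Fintype.card P < D * D) :
    Good f g A B D := by
  classical
  have hSB : ∀ S ∈ A, ∀ T ∈ B, SBelow f g S T → S ⊆ B' := by
    intro S hS T hT hST x hx
    exact (hB' x).2 ⟨T, hT, fun w hw y hy => by rw [Set.mem_singleton_iff.1 hw]; exact hST x hx y hy⟩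
  have hTA : ∀ S ∈ A, ∀ T ∈ B, SBelow f g S T → T ⊆ A' := by
    intro S hS T hT hST x hx
    exact (hA' x).2 ⟨S, hS, fun w hw y hy => by rw [Set.mem_singleton_iff.1 hy]; exact hST w hw x hx⟩
  have hdis : ∀ x ∈ A', x ∉ B' := by
    intro x hx hx2
    obtain ⟨S, hS, hS2⟩ := (hA' x).1 hx
    obtain ⟨T, hT, hT2⟩ := (hB' x).1 hx2
    exact hmid x S hS T hT hS2 hT2
  have hfne : ∀ x ∈ A', ∀ y ∈ B', f x ≠ f y := fun x hx y hy h => hdis x hx (hf h ▸ hy)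
  have hgne : ∀ x ∈ A', ∀ y ∈ B', g x ≠ g y := fun x hx y hy h => hdis x hx (hg h ▸ hy)
  have hcomp : ∀ x ∈ A', ∀ y ∈ B', f x < f y → g y < g x := by
    intro x hx y hy h
    have := hgne x hx y hy
    by_contra hc
    refine hdis x hx ((hB' x).2 ?_)
    obtain ⟨T, hT, hT2⟩ := (hB' y).1 hy
    refine ⟨T, hT, ?_⟩
    rintro w hw z hz
    rw [Set.mem_singleton_iff.1 hw]
    have := hT2 y rfl z hz
    omega
  push Not at hV hH
  obtain ⟨a1, ha1, b1, hb1, hab1⟩ := hV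
  obtain ⟨a2, ha2, b2, hb2, hab2⟩ := hH
  obtain ⟨a', ha', ha'min⟩ := Set.exists_min_image A' g (Set.toFinite _) ⟨a1, ha1⟩
  obtain ⟨b', hb', hb'max⟩ := Set.exists_max_image B' g (Set.toFinite _) ⟨b1, hb1⟩
  obtain ⟨a, ha, hamin⟩ := Set.exists_min_image A' f (Set.toFinite _) ⟨a1, ha1⟩
  obtain ⟨b, hb, hbmax⟩ := Set.exists_max_image B' f (Set.toFinite _) ⟨b1, hb1⟩
  have hg1 : g a' < g b' := by
    have := ha'min a1 ha1
    have := hb'max b1 hb1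
    have := hgne a' ha' b' hb'
    omega
  have hf1 : f a < f b := by
    have := hamin a2 ha2
    have := hbmax b2 hb2
    have := hfne a ha b hb
    omega
  have hg2 : g b < g a := hcomp a ha b hb hf1
  have hf2 : f b' < f a' := by
    have := hfne a' ha' b' hb'
    have := hcomp a' ha' b' hb'
    by_contra hc
    have := this (by omega)
    omega
  have hUL := exists_UL hg h321
  set U : Set P := {z | ∀ y, f y < f z → g y < g z} with hUdef
  have hU := hUL.monoU hf hg
  have hL := hUL.monoL hf hg
  obtain ⟨haU, hbU⟩ := hUL a b hf1 hg2
  obtain ⟨hb'U, ha'U⟩ := hUL b' a' hf2 hg1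
  have hg3 : g b < g a' := by
    by_contra hc
    have h1 := hgne a' ha' b hb
    have := (hL.lt ha'U hbU).2 (by omega)
    have := hcomp a' ha' b hb this
    omega
  have hf3 : f b' < f a := by
    by_contra hc
    have h1 := hfne a ha b' hb'
    have := hcomp a ha b' hb' (by omega)
    have := (hU.lt hb'U haU).2 this
    omega
  obtain ⟨e, ⟨heU, he1⟩, hemax⟩ := Set.exists_max_image {z | z ∉ U ∧ g z < g a'} g (Set.toFinite _)
    ⟨b, hbU, hg3⟩
  have hbe : g b ≤ g e := hemax b ⟨hbU, hg3⟩
  have hbe2 : f b ≤ f e := (hL b hbU e heU).2 hbe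
  have heA : e ∉ A' := fun h => by have := ha'min e h; omega
  set V : Set P := {z | g e < g z ∧ g z ≤ g b'} with hVdef
  have hVc : FConvex g V := by
    intro x hx y hy z h1 h2
    exact ⟨lt_of_lt_of_le hx.1 h1, h2.trans hy.2⟩
  obtain ⟨C, hVC, c1, c2, c3⟩ := strip hf hg hUL V hVc e heU (by
    intro u hu hu2
    have h1 : g u ≤ g b' := by
      rcases hu2 with hu2 | hu2
      · exact hu2.2
      · omega
    have := (hU u hu b' hb'U).2 h1
    omega) D hD
  refine ⟨{e, a'}, Finset.card_le_two, C, c1, c2, ?_⟩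
  intro S hS T hT hST hd
  have hde : e ∉ S ∧ e ∉ T := hd e (by simp)
  have hda : a' ∉ S ∧ a' ∉ T := hd a' (by simp)
  constructor
  · have : ∃ x ∈ S, ¬ (f x < f e ∧ g x < g e) := by
      by_contra hc
      push Not at hc
      refine heA ((hA' e).2 ⟨S, hS, ?_⟩)
      rintro w hw y hy
      rw [Set.mem_singleton_iff.1 hy]
      exact hc w hw
    obtain ⟨x, hx, hx2⟩ := this
    refine ⟨x, Or.inl hx, hVC ⟨?_, hb'max x (hSB S hS T hT hST hx)⟩⟩
    have h1 : g e ≠ g x := fun h => hde.1 (hg h ▸ hx)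
    have h2 : f e ≠ f x := fun h => hde.1 (hf h ▸ hx)
    by_contra hc
    exact heU (hUL e x (by omega) (by omega)).1
  · have : ∃ y ∈ T, ¬ (f a' < f y ∧ g a' < g y) := by
      by_contra hc
      push Not at hc
      refine hdis a' ha' ((hB' a').2 ⟨T, hT, ?_⟩)
      rintro w hw y hy
      rw [Set.mem_singleton_iff.1 hw]
      exact hc y hy
    obtain ⟨y, hy, hy2⟩ := this
    have hyA := hTA S hS T hT hST hy
    have h1 : g a' ≠ g y := fun h => hda.2 (hg h ▸ hy)
    have h2 : f a' ≠ f y := fun h => hda.2 (hf h ▸ hy)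
    have h3 := ha'min y hyA
    have h4 : f y < f a' := by omega
    have hyU : y ∈ U := (hUL y a' h4 (by omega)).1
    have h5 : g b' < g y := by
      by_contra hc
      have h1 := hgne y hyA b' hb'
      have := (hU.lt hyU hb'U).2 (by omega)
      have := hcomp y hyA b' hb' this
      omega
    refine ⟨y, Or.inr hy, fun hyC => ?_⟩
    rcases c3 y hyC with h | h | h
    · have := h.2; omega
    · omega
    · obtain ⟨l, hl, hlV, hly⟩ := h.1 hyU
      have := (hL.lt hl ha'U).1 (by omega)
      have := hemax l ⟨hl, this⟩
      have := hlV.1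
      omega

theorem comb [Fintype P] [Nonempty P] (hf : Function.Injective f) (hg : Function.Injective g)
    (h321 : No321 f g) (hmid : NoMid f g A B) (hD : Fintype.card P < D * D) :
    Good f g A B D := by
  by_cases hA0 : ∅ ∈ A
  · exact good_emptyLeft hf hg h321 hmid hA0 hD
  by_cases hB0 : ∅ ∈ B
  · refine Good.neg (good_emptyLeft ?_ ?_ ?_ ?_ hB0 hD)
    · intro x y h; exact hf (neg_injective h)
    · intro x y h; exact hg (neg_injective h)
    · intro x y z h1 h2 h3 h4
      exact h321 z y x (by simpa using h2) (by simpa using h1) (by simpa using h4) (by simpa using h3)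
    · intro x S hS T hT h1 h2
      refine hmid x T hT S hS ?_ ?_
      · intro u hu v hv
        have := h2 v hv u hu
        simpa using this
      · intro u hu v hv
        have := h1 v hv u hu
        simpa using this
  set A' : Set P := {x | ∃ S ∈ A, SBelow f g S {x}} with hA'
  set B' : Set P := {x | ∃ T ∈ B, SBelow f g {x} T} with hB'
  by_cases hV : ∀ a ∈ A', ∀ b ∈ B', g b < g a
  · exact good_V hf hg h321 hA0 hB0 A' B' (fun _ => Iff.rfl) (fun _ => Iff.rfl) hV hD
  by_cases hH : ∀ a ∈ A', ∀ b ∈ B', f b < f a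
  · refine Good.swap (good_V hg hf ?_ hA0 hB0 A' B' ?_ ?_ hH hD)
    · intro x y z h1 h2 h3 h4
      exact h321 z y x h4 h3 h2 h1
    · intro x
      exact ⟨fun ⟨S, hS, h⟩ => ⟨S, hS, fun u hu v hv => (h u hu v hv).symm⟩,
        fun ⟨S, hS, h⟩ => ⟨S, hS, fun u hu v hv => (h u hu v hv).symm⟩⟩
    · intro x
      exact ⟨fun ⟨S, hS, h⟩ => ⟨S, hS, fun u hu v hv => (h u hu v hv).symm⟩,
        fun ⟨S, hS, h⟩ => ⟨S, hS, fun u hu v hv => (h u hu v hv).symm⟩⟩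
  exact good_iv hf hg h321 hmid A' B' (fun _ => Iff.rfl) (fun _ => Iff.rfl) hV hH hD

end Part1c

section Part2

def posF (n : ℕ) : Fin n → ℤ := fun x => ((x : ℕ) : ℤ)
def valF {n : ℕ} (π : Equiv.Perm (Fin n)) : Fin n → ℤ := fun x => ((π x : ℕ) : ℤ)

lemma posF_inj (n : ℕ) : Function.Injective (posF n) := by
  intro x y h
  simp only [posF] at h
  exact Fin.ext (by exact_mod_cast h)

lemma valF_inj {n : ℕ} (π : Equiv.Perm (Fin n)) : Function.Injective (valF π) := by
  intro x y h
  exact π.injective (posF_inj n h)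

lemma posF_le {n : ℕ} {x y : Fin n} : posF n x ≤ posF n y ↔ x ≤ y := by
  simp [posF]
lemma posF_lt {n : ℕ} {x y : Fin n} : posF n x < posF n y ↔ x < y := by
  simp [posF]
lemma valF_lt {n : ℕ} {π : Equiv.Perm (Fin n)} {x y : Fin n} : valF π x < valF π y ↔ π x < π y := by
  simp [valF]

lemma exists_pattern {n : ℕ} (π : Equiv.Perm (Fin n)) (S : Finset (Fin n)) (k : ℕ) (hk : S.card = k) :
    ∃ (σ : Equiv.Perm (Fin k)) (f : Fin k → Fin n), IsEmbedding σ π f ∧ Set.range f = S := by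
  classical
  have hT : (S.map π.toEmbedding).card = k := by simpa using hk
  set e := S.orderEmbOfFin hk with he
  have hmem : ∀ i, π (e i) ∈ S.map π.toEmbedding := fun i => by
    rw [Finset.mem_map]
    exact ⟨e i, Finset.orderEmbOfFin_mem S hk i, rfl⟩
  let s : Fin k → Fin k := fun i => ((S.map π.toEmbedding).orderIsoOfFin hT).symm ⟨π (e i), hmem i⟩
  have hs : Function.Injective s := by
    intro i j h
    have := ((S.map π.toEmbedding).orderIsoOfFin hT).symm.injective h
    simpa using this
  refine ⟨Equiv.ofBijective s (Finite.injective_iff_bijective.1 hs), e, ⟨e.strictMono, ?_⟩, ?_⟩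
  · intro a b
    simp [s]
  · simp [he]

lemma embedding_unique {k n : ℕ} {σ : Equiv.Perm (Fin k)} {π π' : Equiv.Perm (Fin n)}
    {f f' : Fin k → Fin n} (h : IsEmbedding σ π f) (h' : IsEmbedding σ π' f')
    (hr : Set.range f = Set.range f') (hv : π '' Set.range f = π' '' Set.range f') :
    ∀ x ∈ Set.range f, π x = π' x := by
  have hff : f = f' := (h.1.range_inj h'.1).1 hr
  subst hff
  have m1 : StrictMono (fun i => π (f (σ.symm i))) := by
    intro a b hab
    exact (h.2 _ _).1 (by simpa using hab)
  have m2 : StrictMono (fun i => π' (f (σ.symm i))) := by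
    intro a b hab
    exact (h'.2 _ _).1 (by simpa using hab)
  have : (fun i => π (f (σ.symm i))) = (fun i => π' (f (σ.symm i))) := by
    refine (m1.range_inj m2).1 ?_
    have e1 : Set.range (fun i => π (f (σ.symm i))) = π '' Set.range f := by
      rw [← Set.range_comp]
      exact σ.symm.surjective.range_comp (fun i => π (f i))
    have e2 : Set.range (fun i => π' (f (σ.symm i))) = π' '' Set.range f := by
      rw [← Set.range_comp]
      exact σ.symm.surjective.range_comp (fun i => π' (f i))
    rw [e1, e2, hv]
  rintro _ ⟨i, rfl⟩
  have := congrFun this (σ i)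
  simpa using this

lemma card_cov (n K : ℕ) : Nat.card {C : Set (Fin n) // Cov (posF n) K C} ≤ (n * n + 1) ^ K := by
  classical
  let φ : (Fin K → Option (Fin n × Fin n)) → Set (Fin n) :=
    fun c => {z | ∃ i a b, c i = some (a, b) ∧ a ≤ z ∧ z ≤ b}
  have hφ : ∀ C : {C : Set (Fin n) // Cov (posF n) K C}, ∃ c, φ c = C.1 := by
    rintro ⟨C, l, hl, hconv, hC⟩
    have hrep : ∀ s ∈ l, ∃ o : Option (Fin n × Fin n), ∀ z, z ∈ s ↔ ∃ a b, o = some (a, b) ∧ a ≤ z ∧ z ≤ b := by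
      intro s hs
      by_cases hne : s.Nonempty
      · obtain ⟨a, ha, ha2⟩ := Set.exists_min_image s id (Set.toFinite _) hne
        obtain ⟨b, hb, hb2⟩ := Set.exists_max_image s id (Set.toFinite _) hne
        refine ⟨some (a, b), fun z => ⟨fun hz => ⟨a, b, rfl, ha2 z hz, hb2 z hz⟩, ?_⟩⟩
        rintro ⟨a', b', h, h1, h2⟩
        simp only [Option.some.injEq, Prod.mk.injEq] at h
        obtain ⟨rfl, rfl⟩ := h
        exact hconv s hs a ha b hb z (posF_le.2 h1) (posF_le.2 h2)
      · refine ⟨none, fun z => ⟨fun hz => absurd ⟨z, hz⟩ hne, ?_⟩⟩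
        rintro ⟨a', b', h, h1, h2⟩
        simp at h
    choose! o ho using hrep
    refine ⟨fun i => if h : (i : ℕ) < l.length then o l[(i : ℕ)] else none, ?_⟩
    ext z
    simp only [φ, Set.mem_setOf_eq]
    rw [hC]
    constructor
    · rintro ⟨i, a, b, h, h1, h2⟩
      by_cases hi : (i : ℕ) < l.length
      · rw [dif_pos hi] at h
        exact ⟨l[(i : ℕ)], List.getElem_mem hi, (ho _ (List.getElem_mem hi) z).2 ⟨a, b, h, h1, h2⟩⟩
      · rw [dif_neg hi] at h; simp at h
    · rintro ⟨s, hs, hz⟩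
      obtain ⟨i, hi, rfl⟩ := List.getElem_of_mem hs
      obtain ⟨a, b, h, h1, h2⟩ := (ho _ hs z).1 hz
      exact ⟨⟨i, by omega⟩, a, b, by simpa [hi] using h, h1, h2⟩
  choose c hc using hφ
  have hinj : Function.Injective c := by
    intro x y h
    apply Subtype.ext
    rw [← hc x, ← hc y, h]
  have := Nat.card_le_card_of_injective c hinj
  refine this.trans ?_
  rw [Nat.card_eq_fintype_card]
  simp

lemma mergeCount (E C1 C2 : Set PermSig) (n K : ℕ)
    (h : ∀ π : Equiv.Perm (Fin n), (⟨n, π⟩ : PermSig) ∈ E → ∃ C : Set (Fin n),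
      Cov (posF n) K C ∧ Cov (valF π) K C ∧
      (∀ k (σ : Equiv.Perm (Fin k)) f, IsEmbedding σ π f → Set.range f = C → (⟨k, σ⟩ : PermSig) ∈ C1) ∧
      (∀ k (σ : Equiv.Perm (Fin k)) f, IsEmbedding σ π f → Set.range f = Cᶜ → (⟨k, σ⟩ : PermSig) ∈ C2)) :
    classCount E n ≤ ((n * n + 1) ^ K) ^ 2 *
      ∑ k : Fin (n + 1), classCount C1 k * classCount C2 (n - k) := by
  classical
  have hval : ∀ (π : Equiv.Perm (Fin n)) (C : Set (Fin n)), Cov (valF π) K C → Cov (posF n) K (π '' C) := by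
    rintro π C ⟨l, h1, h2, h3⟩
    refine ⟨l.map (fun s => π '' s), by simpa using h1, ?_, ?_⟩
    · intro s hs
      obtain ⟨t, ht, rfl⟩ := List.mem_map.1 hs
      rintro _ ⟨x, hx, rfl⟩ _ ⟨y, hy, rfl⟩ z hz1 hz2
      refine ⟨π.symm z, h2 t ht x hx y hy _ ?_ ?_, by simp⟩
      · simpa [valF, posF] using hz1
      · simpa [valF, posF] using hz2
    · intro z
      simp only [Set.mem_image, List.mem_map, h3]
      constructor
      · rintro ⟨x, ⟨s, hs, hx⟩, rfl⟩
        exact ⟨_, ⟨s, hs, rfl⟩, x, hx, rfl⟩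
      · rintro ⟨_, ⟨s, hs, rfl⟩, x, hx, rfl⟩
        exact ⟨x, ⟨s, hs, hx⟩, rfl⟩
  let W := {C : Set (Fin n) // Cov (posF n) K C}
  let T := Σ k : Fin (n + 1), {π : Equiv.Perm (Fin k) // (⟨k, π⟩ : PermSig) ∈ C1} ×
    {π : Equiv.Perm (Fin (n - k)) // (⟨n - k, π⟩ : PermSig) ∈ C2}
  have hcode : ∀ π : {π : Equiv.Perm (Fin n) // (⟨n, π⟩ : PermSig) ∈ E}, ∃ w : (W × W) × T,
      w.1.2.1 = π.1 '' w.1.1.1 ∧ (∃ f, IsEmbedding w.2.2.1.1 π.1 f ∧ Set.range f = w.1.1.1) ∧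
      (∃ f, IsEmbedding w.2.2.2.1 π.1 f ∧ Set.range f = w.1.1.1ᶜ) := by
    rintro ⟨π, hπ⟩
    obtain ⟨C, c1, c2, c3, c4⟩ := h π hπ
    have hk : C.toFinset.card ≤ n := by simpa using Finset.card_le_univ C.toFinset
    obtain ⟨σ, f, hf, hfr⟩ := exists_pattern π C.toFinset _ rfl
    obtain ⟨τ, g, hg, hgr⟩ := exists_pattern π C.toFinsetᶜ (n - C.toFinset.card)
      (by rw [Finset.card_compl, Fintype.card_fin])
    have hfr' : Set.range f = C := by simpa using hfr
    have hgr' : Set.range g = Cᶜ := by simpa using hgr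
    exact ⟨((⟨C, c1⟩, ⟨π '' C, hval π C c2⟩), ⟨⟨C.toFinset.card, by omega⟩,
      ⟨σ, c3 _ σ f hf hfr'⟩, ⟨τ, c4 _ τ g hg hgr'⟩⟩), rfl, ⟨f, hf, hfr'⟩, ⟨g, hg, hgr'⟩⟩
  choose c hc1 hc2 hc3 using hcode
  have hinj : Function.Injective c := by
    intro π π' heq
    have a1 := hc1 π
    have a2 := hc2 π
    have a3 := hc3 π
    have b1 := hc1 π'
    have b2 := hc2 π'
    have b3 := hc3 π'
    rw [← heq] at b1 b2 b3
    generalize c π = w at *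
    obtain ⟨f, hf, hfr⟩ := a2
    obtain ⟨f', hf', hfr'⟩ := b2
    obtain ⟨g, hg, hgr⟩ := a3
    obtain ⟨g', hg', hgr'⟩ := b3
    have e1 := embedding_unique hf hf' (hfr.trans hfr'.symm) (by rw [hfr', hfr, ← a1, b1])
    have e2 := embedding_unique hg hg' (hgr.trans hgr'.symm) (by
      rw [hgr', hgr, Set.image_compl_eq π.1.bijective, Set.image_compl_eq π'.1.bijective, ← a1, b1])
    apply Subtype.ext
    apply Equiv.ext
    intro x
    by_cases hx : x ∈ w.1.1.1
    · exact e1 x (hfr ▸ hx)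
    · exact e2 x (hgr ▸ hx)
  have h1 := Nat.card_le_card_of_injective c hinj
  have h2 : Nat.card T = ∑ k : Fin (n + 1), classCount C1 k * classCount C2 (n - k) := by
    rw [Nat.card_sigma]
    refine Finset.sum_congr rfl fun k _ => ?_
    rw [Nat.card_prod]; rfl
  rw [Nat.card_prod, Nat.card_prod, h2] at h1
  refine h1.trans (Nat.mul_le_mul_right _ ?_)
  rw [sq]
  exact Nat.mul_le_mul (card_cov n K) (card_cov n K)

end Part2

section Part2b

lemma bound_of_growth {C : Set PermSig} {r : NNReal} (hr : 0 < r) (h : growthRate C < r) :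
    ∃ M : ℝ, 1 ≤ M ∧ ∀ n, (classCount C n : ℝ) ≤ M * (r : ℝ) ^ n := by
  have h1 : ∀ᶠ n : ℕ in atTop, (classCount C n : ENNReal) ^ (1 / (n : ℝ)) < r :=
    eventually_lt_of_limsup_lt h
  obtain ⟨N, hN⟩ := eventually_atTop.1 (h1.and (eventually_ge_atTop 1))
  have hr' : (0 : ℝ) < r := hr
  have hnn : ∀ n, (0 : ℝ) ≤ (classCount C n : ℝ) / (r : ℝ) ^ n := fun n => by positivity
  refine ⟨1 + ∑ n ∈ Finset.range N, (classCount C n : ℝ) / (r : ℝ) ^ n, ?_, ?_⟩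
  · have := Finset.sum_nonneg (s := Finset.range N) (fun n _ => hnn n)
    linarith
  · intro n
    rw [← div_le_iff₀ (by positivity)]
    have hs := Finset.sum_nonneg (s := Finset.range N) (fun n _ => hnn n)
    by_cases hn : n < N
    · have := Finset.single_le_sum (f := fun n => (classCount C n : ℝ) / (r : ℝ) ^ n)
        (fun n _ => hnn n) (Finset.mem_range.2 hn)
      linarith
    · obtain ⟨h2, h3⟩ := hN n (not_lt.1 hn)
      have h4 : ((classCount C n : ENNReal) ^ (1 / (n : ℝ))) ^ n ≤ (r : ENNReal) ^ n :=
        pow_le_pow_left' h2.le n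
      rw [← ENNReal.rpow_natCast, ← ENNReal.rpow_mul, one_div,
        inv_mul_cancel₀ (by positivity), ENNReal.rpow_one] at h4
      have h5 : ((classCount C n : NNReal)) ≤ r ^ n := by exact_mod_cast h4
      have h6 : (classCount C n : ℝ) ≤ (r : ℝ) ^ n := by exact_mod_cast h5
      have : (classCount C n : ℝ) / (r : ℝ) ^ n ≤ 1 := by
        rw [div_le_one (by positivity)]; exact h6
      linarith

lemma growth_le {C : Set PermSig} {R : NNReal}
    (h : ∀ᶠ n : ℕ in atTop, (classCount C n : ℝ) ≤ (R : ℝ) ^ n) : growthRate C ≤ R := by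
  unfold growthRate
  refine limsup_le_of_le (by isBoundedDefault) ?_
  filter_upwards [h, eventually_ge_atTop 1] with n hn hn1
  have h1 : (classCount C n : NNReal) ≤ R ^ n := by exact_mod_cast hn
  have h2 : (classCount C n : ENNReal) ≤ (R : ENNReal) ^ n := by exact_mod_cast h1
  calc (classCount C n : ENNReal) ^ (1 / (n : ℝ)) ≤ ((R : ENNReal) ^ n) ^ (1 / (n : ℝ)) :=
        ENNReal.rpow_le_rpow h2 (by positivity)
    _ = R := by
      rw [← ENNReal.rpow_natCast, ← ENNReal.rpow_mul, one_div,
        mul_inv_cancel₀ (by positivity), ENNReal.rpow_one]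

lemma asymp (t M : ℝ) (ht : 1 < t) (hM : 1 ≤ M) :
    ∀ᶠ D : ℕ in atTop, M * (D : ℝ) ^ (40 * D + 2) ≤ t ^ ((D - 1) * (D - 1)) := by
  have hlt : 0 < Real.log t := Real.log_pos ht
  have h1 : ∀ᶠ D : ℕ in atTop, ‖Real.log (D : ℝ)‖ ≤ (Real.log t / 172) * ‖(D : ℝ)‖ :=
    tendsto_natCast_atTop_atTop.eventually
      (Real.isLittleO_log_id_atTop.bound (by positivity : 0 < Real.log t / 172))
  have h2 : ∀ᶠ D : ℕ in atTop, Real.log M / (Real.log t / 172) ≤ (D : ℝ) :=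
    tendsto_natCast_atTop_atTop.eventually (eventually_ge_atTop _)
  filter_upwards [h1, h2, eventually_ge_atTop 2] with D h1 h2 hD
  have hD' : (2 : ℝ) ≤ D := by exact_mod_cast hD
  have hlD : 0 ≤ Real.log (D : ℝ) := Real.log_nonneg (by linarith)
  rw [Real.norm_of_nonneg hlD, Real.norm_of_nonneg (by linarith)] at h1
  rw [div_le_iff₀ (by positivity)] at h2
  rw [← Real.log_le_log_iff (by positivity) (by positivity), Real.log_mul (by positivity) (by positivity),
    Real.log_pow, Real.log_pow]
  push_cast [Nat.cast_sub (show 1 ≤ D by omega)]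
  set L := Real.log t / 172 with hL
  have hL0 : 0 < L := by positivity
  have hLt : Real.log t = 172 * L := by rw [hL]; ring
  rw [hLt]
  have a1 : (40 * (D : ℝ) + 2) * Real.log D ≤ (40 * D + 2) * (L * D) :=
    mul_le_mul_of_nonneg_left h1 (by linarith)
  have a2 : (40 * (D : ℝ) + 2) * (L * D) ≤ L * (41 * (D * D)) := by
    nlinarith [mul_nonneg hL0.le (show (0 : ℝ) ≤ D * (D - 2) by nlinarith)]
  have a3 : (D : ℝ) * L ≤ L * (D * D) := by
    nlinarith [mul_nonneg hL0.le (show (0 : ℝ) ≤ D * (D - 1) by nlinarith)]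
  have a4 : L * (D * D) ≤ L * (4 * ((D - 1) * (D - 1))) :=
    mul_le_mul_of_nonneg_left (by nlinarith) hL0.le
  nlinarith

/-- `π` splits by a set with few intervals into patterns from `C1` and `C2` -/
def SplitsInto (C1 C2 : Set PermSig) (n K : ℕ) (π : Equiv.Perm (Fin n)) : Prop :=
  ∃ C : Set (Fin n), Cov (posF n) K C ∧ Cov (valF π) K C ∧
      (∀ k (σ : Equiv.Perm (Fin k)) f, IsEmbedding σ π f → Set.range f = C → (⟨k, σ⟩ : PermSig) ∈ C1) ∧
      (∀ k (σ : Equiv.Perm (Fin k)) f, IsEmbedding σ π f → Set.range f = Cᶜ → (⟨k, σ⟩ : PermSig) ∈ C2)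

theorem merge_growth (E C1 C2 : Set PermSig)
    (h : ∀ n : ℕ, 1 ≤ n → ∀ π : Equiv.Perm (Fin n), (⟨n, π⟩ : PermSig) ∈ E →
      SplitsInto C1 C2 n (5 * (n.sqrt + 1)) π) :
    growthRate E ≤ max (growthRate C1) (growthRate C2) := by
  refine le_of_forall_gt fun R hR => ?_
  obtain ⟨R', hR1, hR2⟩ := exists_between hR
  obtain ⟨r', hr1, hr2⟩ := exists_between hR1
  have hR't : R' ≠ ⊤ := ne_top_of_lt hR2
  have hr't : r' ≠ ⊤ := ne_top_of_lt hr2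
  lift R' to NNReal using hR't
  lift r' to NNReal using hr't
  have hr0 : 0 < r' := by
    have : (0 : ENNReal) < r' := lt_of_le_of_lt zero_le hr1
    exact_mod_cast this
  have hrR : r' < R' := by exact_mod_cast hr2
  refine lt_of_le_of_lt ?_ hR2
  obtain ⟨M1, hM1, hc1⟩ := bound_of_growth hr0 (lt_of_le_of_lt (le_max_left _ _) hr1)
  obtain ⟨M2, hM2, hc2⟩ := bound_of_growth hr0 (lt_of_le_of_lt (le_max_right _ _) hr1)
  apply growth_le
  have hr0' : (0 : ℝ) < r' := hr0
  have hrR' : (r' : ℝ) < R' := hrR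
  have hsq : Tendsto (fun n : ℕ => n.sqrt + 1) atTop atTop := by
    refine tendsto_atTop_mono (fun n => Nat.le_succ _) ?_
    refine tendsto_atTop.2 fun b => ?_
    filter_upwards [eventually_ge_atTop (b * b)] with n hn
    exact Nat.le_sqrt.2 hn
  have has := hsq.eventually (asymp ((R' : ℝ) / r') (M1 * M2) ((one_lt_div hr0').2 hrR') (by nlinarith))
  filter_upwards [has, eventually_ge_atTop 1] with n hn hn1
  have hm := mergeCount E C1 C2 n _ (h n hn1)
  set D := n.sqrt + 1 with hD
  have hnD : n + 1 ≤ D * D := Nat.lt_succ_sqrt n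
  have hDn : (D - 1) * (D - 1) ≤ n := by
    rw [hD, Nat.add_sub_cancel]; exact Nat.sqrt_le n
  have hsum : ((∑ k : Fin (n + 1), classCount C1 k * classCount C2 (n - k) : ℕ) : ℝ) ≤
      (n + 1) * (M1 * M2 * (r' : ℝ) ^ n) := by
    push_cast
    calc _ ≤ ∑ k : Fin (n + 1), (M1 * M2 * (r' : ℝ) ^ n) := by
          refine Finset.sum_le_sum fun k _ => ?_
          have e : (r' : ℝ) ^ n = (r' : ℝ) ^ (k : ℕ) * (r' : ℝ) ^ (n - (k : ℕ)) := by
            rw [← pow_add]; congr 1; omega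
          rw [e]
          calc _ ≤ (M1 * (r' : ℝ) ^ (k : ℕ)) * (M2 * (r' : ℝ) ^ (n - (k : ℕ))) :=
                mul_le_mul (hc1 _) (hc2 _) (by positivity) (by positivity)
            _ = _ := by ring
      _ = _ := by simp
  have hn1D : ((n : ℝ) + 1) ≤ (D : ℝ) ^ 2 := by
    have : ((n + 1 : ℕ) : ℝ) ≤ ((D * D : ℕ) : ℝ) := by exact_mod_cast hnD
    push_cast at this; nlinarith
  have hnn : ((n : ℝ) * n + 1) ≤ (D : ℝ) ^ 4 := by
    have h0 : (0 : ℝ) ≤ n := by positivity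
    calc ((n : ℝ) * n + 1) ≤ (n + 1) * (n + 1) := by nlinarith
      _ ≤ (D : ℝ) ^ 2 * (D : ℝ) ^ 2 := mul_le_mul hn1D hn1D (by positivity) (by positivity)
      _ = _ := by ring
  have hpow : (((n : ℝ) * n + 1) ^ (5 * D)) ^ 2 ≤ (D : ℝ) ^ (40 * D) := by
    calc (((n : ℝ) * n + 1) ^ (5 * D)) ^ 2 ≤ (((D : ℝ) ^ 4) ^ (5 * D)) ^ 2 := by gcongr
      _ = _ := by rw [← pow_mul, ← pow_mul]; congr 1; ring
  have hR0 : (0 : ℝ) < R' := hr0'.trans hrR'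
  calc (classCount E n : ℝ) ≤ ((((n * n + 1) ^ (5 * D)) ^ 2 *
          ∑ k : Fin (n + 1), classCount C1 k * classCount C2 (n - k) : ℕ) : ℝ) := by exact_mod_cast hm
    _ = (((n : ℝ) * n + 1) ^ (5 * D)) ^ 2 *
        ((∑ k : Fin (n + 1), classCount C1 k * classCount C2 (n - k) : ℕ) : ℝ) := by push_cast; rfl
    _ ≤ (D : ℝ) ^ (40 * D) * ((D : ℝ) ^ 2 * (M1 * M2 * (r' : ℝ) ^ n)) := by
        refine mul_le_mul hpow (hsum.trans ?_) (by positivity) (by positivity)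
        exact mul_le_mul_of_nonneg_right hn1D (by positivity)
    _ = (M1 * M2 * (D : ℝ) ^ (40 * D + 2)) * (r' : ℝ) ^ n := by ring
    _ ≤ ((R' : ℝ) / r') ^ ((D - 1) * (D - 1)) * (r' : ℝ) ^ n :=
        mul_le_mul_of_nonneg_right hn (by positivity)
    _ ≤ ((R' : ℝ) / r') ^ n * (r' : ℝ) ^ n := by
        refine mul_le_mul_of_nonneg_right ?_ (by positivity)
        exact pow_le_pow_right₀ ((one_lt_div hr0').2 hrR').le hDn
    _ = (R' : ℝ) ^ n := by rw [div_pow]; field_simp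

lemma growth_mono {C C' : Set PermSig} (h : C ⊆ C') : growthRate C ≤ growthRate C' := by
  unfold growthRate
  refine limsup_le_limsup (Eventually.of_forall fun n => ?_)
  refine ENNReal.rpow_le_rpow ?_ (by positivity)
  have : classCount C n ≤ classCount C' n :=
    Nat.card_le_card_of_injective (fun π => ⟨π.1, h π.2⟩) (by
      intro x y hxy; simpa [Subtype.ext_iff] using hxy)
  exact_mod_cast this

lemma growth_small : growthRate {π | π.1 ≤ 2} = 0 := by
  refine le_antisymm ?_ zero_le
  have := growth_le (C := {π | π.1 ≤ 2}) (R := 0) (by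
    filter_upwards [eventually_ge_atTop 3] with n hn
    have : classCount {π | π.1 ≤ 2} n = 0 := by
      unfold classCount
      have : IsEmpty {π : Equiv.Perm (Fin n) // (⟨n, π⟩ : PermSig) ∈ {π : PermSig | π.1 ≤ 2}} :=
        ⟨fun π => by have := π.2; simp only [Set.mem_setOf_eq] at this; omega⟩
      exact Nat.card_of_isEmpty
    rw [this]; simp)
  simpa using this

/-- removing at most two points does not change the growth rate -/
theorem growth_delete (E C : Set PermSig)
    (h : ∀ n : ℕ, ∀ π : Equiv.Perm (Fin n), (⟨n, π⟩ : PermSig) ∈ E →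
      ∃ Δ : Finset (Fin n), Δ.card ≤ 2 ∧
      (∀ k (σ : Equiv.Perm (Fin k)) f, IsEmbedding σ π f → Set.range f = (Δ : Set (Fin n))ᶜ → (⟨k, σ⟩ : PermSig) ∈ C)) :
    growthRate E ≤ growthRate C := by
  have := merge_growth E {π | π.1 ≤ 2} C (by
    intro n hn π hπ
    obtain ⟨Δ, h1, h2⟩ := h n π hπ
    refine ⟨Δ, (Cov.of_finset (posF_inj n) Δ).mono (by omega),
      (Cov.of_finset (valF_inj π) Δ).mono (by omega), ?_, h2⟩
    intro k σ f hf hfr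
    have e : Fintype.card (Fin k) = Δ.card := by
      classical
      rw [← Finset.card_univ, ← Finset.card_image_of_injective _ hf.1.injective]
      congr 1
      apply Finset.coe_injective
      simpa using hfr
    show k ≤ 2
    rw [Fintype.card_fin] at e
    omega)
  rwa [growth_small, max_eq_right zero_le] at this

end Part2b

section Part3

lemma dsum_castAdd {a b : ℕ} (α : Equiv.Perm (Fin a)) (β : Equiv.Perm (Fin b)) (i : Fin a) :
    dsum α β (Fin.castAdd b i) = Fin.castAdd b (α i) := by
  simp [dsum]

lemma dsum_natAdd {a b : ℕ} (α : Equiv.Perm (Fin a)) (β : Equiv.Perm (Fin b)) (i : Fin b) :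
    dsum α β (Fin.natAdd a i) = Fin.natAdd a (β i) := by
  simp [dsum]

lemma castAdd_lt_natAdd {a b : ℕ} (i : Fin a) (j : Fin b) : Fin.castAdd b i < Fin.natAdd a j := by
  rw [Fin.lt_def]; simp; omega

lemma IsEmbedding.comp {k m n : ℕ} {σ : Equiv.Perm (Fin k)} {τ : Equiv.Perm (Fin m)}
    {π : Equiv.Perm (Fin n)} {f : Fin k → Fin m} {g : Fin m → Fin n}
    (hg : IsEmbedding τ π g) (hf : IsEmbedding σ τ f) : IsEmbedding σ π (g ∘ f) :=
  ⟨hg.1.comp hf.1, fun a b => (hf.2 a b).trans (hg.2 _ _)⟩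

lemma Involves.trans {α β γ : PermSig} (h1 : Involves α β) (h2 : Involves β γ) : Involves α γ := by
  obtain ⟨f, hf⟩ := h1
  obtain ⟨g, hg⟩ := h2
  exact ⟨g ∘ f, hg.comp hf⟩

lemma emb_dsum_left {a b n : ℕ} {α : Equiv.Perm (Fin a)} {β : Equiv.Perm (Fin b)}
    {π : Equiv.Perm (Fin n)} {h : Fin (a + b) → Fin n} (hh : IsEmbedding (dsum α β) π h) :
    IsEmbedding α π (h ∘ Fin.castAdd b) := by
  refine hh.comp ⟨Fin.strictMono_castAdd b, fun x y => ?_⟩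
  rw [dsum_castAdd, dsum_castAdd]
  exact (Fin.strictMono_castAdd b).lt_iff_lt.symm

lemma emb_dsum_right {a b n : ℕ} {α : Equiv.Perm (Fin a)} {β : Equiv.Perm (Fin b)}
    {π : Equiv.Perm (Fin n)} {h : Fin (a + b) → Fin n} (hh : IsEmbedding (dsum α β) π h) :
    IsEmbedding β π (h ∘ Fin.natAdd a) := by
  refine hh.comp ⟨Fin.strictMono_natAdd a, fun x y => ?_⟩
  rw [dsum_natAdd, dsum_natAdd]
  exact (Fin.strictMono_natAdd a).lt_iff_lt.symm

lemma emb_dsum_cross {a b n : ℕ} {α : Equiv.Perm (Fin a)} {β : Equiv.Perm (Fin b)}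
    {π : Equiv.Perm (Fin n)} {h : Fin (a + b) → Fin n} (hh : IsEmbedding (dsum α β) π h)
    (i : Fin a) (j : Fin b) : h (Fin.castAdd b i) < h (Fin.natAdd a j) ∧
      π (h (Fin.castAdd b i)) < π (h (Fin.natAdd a j)) := by
  refine ⟨hh.1 (castAdd_lt_natAdd i j), (hh.2 _ _).1 ?_⟩
  rw [dsum_castAdd, dsum_natAdd]
  exact castAdd_lt_natAdd _ _

lemma emb_append {a b n : ℕ} {α : Equiv.Perm (Fin a)} {β : Equiv.Perm (Fin b)}
    {π : Equiv.Perm (Fin n)} {f : Fin a → Fin n} {g : Fin b → Fin n}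
    (hf : IsEmbedding α π f) (hg : IsEmbedding β π g)
    (hc : ∀ i j, f i < g j ∧ π (f i) < π (g j)) : IsEmbedding (dsum α β) π (Fin.append f g) := by
  constructor
  · intro x y
    refine Fin.addCases (fun i => ?_) (fun i => ?_) x <;>
      refine Fin.addCases (fun j => ?_) (fun j => ?_) y <;> intro hxy
    · simpa using hf.1 ((Fin.strictMono_castAdd b).lt_iff_lt.1 hxy)
    · simpa using (hc i j).1
    · exact absurd hxy (castAdd_lt_natAdd _ _).not_gt
    · simpa using hg.1 ((Fin.strictMono_natAdd a).lt_iff_lt.1 hxy)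
  · intro x y
    refine Fin.addCases (fun i => ?_) (fun i => ?_) x <;>
      refine Fin.addCases (fun j => ?_) (fun j => ?_) y
    · rw [dsum_castAdd, dsum_castAdd, Fin.append_left, Fin.append_left, ← hf.2]
      exact (Fin.strictMono_castAdd b).lt_iff_lt
    · rw [dsum_castAdd, dsum_natAdd, Fin.append_left, Fin.append_right]
      exact iff_of_true (castAdd_lt_natAdd _ _) (hc i j).2
    · rw [dsum_castAdd, dsum_natAdd, Fin.append_left, Fin.append_right]
      exact iff_of_false (castAdd_lt_natAdd _ _).not_gt (hc j i).2.not_gt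
    · rw [dsum_natAdd, dsum_natAdd, Fin.append_right, Fin.append_right, ← hg.2]
      exact (Fin.strictMono_natAdd a).lt_iff_lt

lemma I2_closed {α π : PermSig} (h : Involves α π) (hπ : π ∈ IkClass 2) : α ∈ IkClass 2 := by
  obtain ⟨f, hf⟩ := h
  rintro ⟨q, hq1, hq2⟩
  exact hπ ⟨f ∘ q, hf.1.comp hq1, fun i j hij => (hf.2 _ _).1 (hq2 hij)⟩

lemma Av_closed {X : Set PermSig} {α π : PermSig} (h : Involves α π) (hπ : π ∈ AvClass X) :
    α ∈ AvClass X := fun x hx hxa => hπ x hx (hxa.trans h)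

lemma no321_of_I2 {n : ℕ} {π : Equiv.Perm (Fin n)} (h : (⟨n, π⟩ : PermSig) ∈ IkClass 2) :
    No321 (posF n) (valF π) := by
  intro x y z h1 h2 h3 h4
  rw [posF_lt] at h1 h2
  rw [valF_lt] at h3 h4
  refine h ⟨![x, y, z], ?_, ?_⟩
  · rw [Fin.strictMono_iff_lt_succ]
    intro i
    fin_cases i
    · exact h1
    · exact h2
  · rw [Fin.strictAnti_iff_succ_lt]
    intro i
    fin_cases i
    · exact h3
    · exact h4

/-- ranges of embeddings of a pattern -/
def Copies (α : PermSig) {n : ℕ} (π : Equiv.Perm (Fin n)) : Set (Set (Fin n)) :=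
  {S | ∃ f, IsEmbedding α.2 π f ∧ Set.range f = S}

lemma noMid_of_av {α β : PermSig} {n : ℕ} {π : Equiv.Perm (Fin n)}
    (h : ¬ Involves (DSum α (DSum (iotaSig 1) β)) ⟨n, π⟩) :
    NoMid (posF n) (valF π) (Copies α π) (Copies β π) := by
  rintro x _ ⟨f, hf, rfl⟩ _ ⟨g, hg, rfl⟩ h1 h2
  have h1' : ∀ i, f i < x ∧ π (f i) < π x := fun i => by
    have := h1 (f i) ⟨i, rfl⟩ x rfl
    rwa [posF_lt, valF_lt] at this
  have h2' : ∀ i, x < g i ∧ π x < π (g i) := fun i => by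
    have := h2 x rfl (g i) ⟨i, rfl⟩
    rwa [posF_lt, valF_lt] at this
  have e1 : IsEmbedding (1 : Equiv.Perm (Fin 1)) π (fun _ : Fin 1 => x) := by
    refine ⟨Subsingleton.strictMono _, fun a b => ?_⟩
    have : a = b := Subsingleton.elim _ _
    subst this
    simp
  have e2 := emb_append e1 hg (fun _ j => h2' j)
  have e3 := emb_append hf e2 (by
    intro i j
    refine Fin.addCases (fun k => ?_) (fun k => ?_) j
    · rw [Fin.append_left]; exact h1' i
    · rw [Fin.append_right]
      exact ⟨(h1' i).1.trans (h2' k).1, (h1' i).2.trans (h2' k).2⟩)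
  exact h ⟨_, e3⟩

theorem step (Z : Set PermSig) (α β : PermSig) :
    growthRate (IkClass 2 ∩ AvClass (insert (DSum α (DSum (iotaSig 1) β)) Z)) ≤
    growthRate (IkClass 2 ∩ AvClass (insert (DSum α β) Z)) := by
  classical
  let F : Set PermSig := {τ | τ ∈ IkClass 2 ∧ τ ∈ AvClass Z ∧ ∃ Δ : Finset (Fin τ.1), Δ.card ≤ 2 ∧
    ∀ f, IsEmbedding (DSum α β).2 τ.2 f → ∃ d ∈ Δ, d ∈ Set.range f}
  have hF : growthRate F ≤ growthRate (IkClass 2 ∩ AvClass (insert (DSum α β) Z)) := by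
    refine growth_delete _ _ fun n π hπ => ?_
    obtain ⟨h1, h2, Δ, h3, h4⟩ := hπ
    refine ⟨Δ, h3, fun k σ f hf hfr => ?_⟩
    have hinv : Involves ⟨k, σ⟩ ⟨n, π⟩ := ⟨f, hf⟩
    refine ⟨I2_closed hinv h1, ?_⟩
    intro x hx
    rcases hx with rfl | hx
    · rintro ⟨g, hg⟩
      obtain ⟨d, hd, i, hi⟩ := h4 _ (hf.comp hg)
      have : d ∈ Set.range f := ⟨g i, hi⟩
      rw [hfr] at this
      exact this hd
    · exact Av_closed hinv h2 x hx
  refine le_trans ?_ (hF.trans' (max_self (growthRate F)).le)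
  refine merge_growth _ _ _ fun n hn π hπ => ?_
  obtain ⟨hπ1, hπ2⟩ := hπ
  have hZ : (⟨n, π⟩ : PermSig) ∈ AvClass Z := fun x hx => hπ2 x (Or.inr hx)
  have : Nonempty (Fin n) := ⟨⟨0, hn⟩⟩
  obtain ⟨Δ, hΔ, C, c1, c2, c3⟩ := comb (posF_inj n) (valF_inj π) (no321_of_I2 hπ1)
    (noMid_of_av (hπ2 _ (Or.inl rfl))) (D := n.sqrt + 1) (by
      rw [Fintype.card_fin]; exact Nat.lt_succ_sqrt n)
  have key : ∀ (C' : Set (Fin n)), (∀ S ∈ Copies α π, ∀ T ∈ Copies β π,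
      SBelow (posF n) (valF π) S T → (∀ d ∈ Δ, d ∉ S ∧ d ∉ T) → ∃ q, (q ∈ S ∨ q ∈ T) ∧ q ∉ C') →
      ∀ k (σ : Equiv.Perm (Fin k)) f, IsEmbedding σ π f → Set.range f = C' → (⟨k, σ⟩ : PermSig) ∈ F := by
    intro C' hC' k σ f hf hfr
    have hinv : Involves ⟨k, σ⟩ ⟨n, π⟩ := ⟨f, hf⟩
    refine ⟨I2_closed hinv hπ1, Av_closed hinv hZ, Finset.univ.filter (fun i => f i ∈ Δ), ?_, ?_⟩
    · refine le_trans ?_ hΔ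
      exact Finset.card_le_card_of_injOn f (by intro i hi; simpa using hi) hf.1.injective.injOn
    · intro g hg
      by_contra hc
      push Not at hc
      have hd : ∀ i, f (g i) ∉ Δ := fun i hi => hc (g i) (by simpa using hi) ⟨i, rfl⟩
      have hfg := hf.comp hg
      obtain ⟨q, hq, hqC⟩ := hC' _ ⟨_, emb_dsum_left hfg, rfl⟩ _ ⟨_, emb_dsum_right hfg, rfl⟩ (by
        rintro _ ⟨i, rfl⟩ _ ⟨j, rfl⟩
        rw [posF_lt, valF_lt]
        exact emb_dsum_cross hfg i j) (by
        intro d hd'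
        constructor
        · rintro ⟨i, rfl⟩
          exact hd _ hd'
        · rintro ⟨i, rfl⟩
          exact hd _ hd')
      apply hqC
      rw [← hfr]
      rcases hq with ⟨i, rfl⟩ | ⟨i, rfl⟩
      · exact ⟨_, rfl⟩
      · exact ⟨_, rfl⟩
  refine ⟨C, c1, c2, key C ?_, key Cᶜ ?_⟩
  · intro S hS T hT hST hd
    exact (c3 S hS T hT hST hd).2
  · intro S hS T hT hST hd
    obtain ⟨p, hp, hpC⟩ := (c3 S hS T hT hST hd).1
    exact ⟨p, hp, fun h => h hpC⟩

end Part3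

section Part4

lemma permSig_ext {a b : PermSig} (h : a.1 = b.1)
    (h2 : ∀ i (hi : i < a.1) (hi' : i < b.1), (a.2 ⟨i, hi⟩ : ℕ) = b.2 ⟨i, hi'⟩) : a = b := by
  obtain ⟨n, σ⟩ := a
  obtain ⟨m, τ⟩ := b
  simp only at h
  subst h
  congr 1
  apply Equiv.ext
  rintro ⟨i, hi⟩
  exact Fin.ext (h2 i hi hi)

lemma dsum_val_lt {a b : ℕ} (α : Equiv.Perm (Fin a)) (β : Equiv.Perm (Fin b)) (i : ℕ)
    (hi : i < a + b) (h : i < a) : (dsum α β ⟨i, hi⟩ : ℕ) = α ⟨i, h⟩ := by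
  have := dsum_castAdd α β ⟨i, h⟩
  have e : Fin.castAdd b ⟨i, h⟩ = ⟨i, hi⟩ := rfl
  rw [e] at this
  rw [this]; rfl

lemma dsum_val_ge {a b : ℕ} (α : Equiv.Perm (Fin a)) (β : Equiv.Perm (Fin b)) (i : ℕ)
    (hi : i < a + b) (h : ¬ i < a) : (dsum α β ⟨i, hi⟩ : ℕ) = a + β ⟨i - a, by omega⟩ := by
  have := dsum_natAdd α β ⟨i - a, by omega⟩
  have e : Fin.natAdd a ⟨i - a, by omega⟩ = (⟨i, hi⟩ : Fin (a + b)) := by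
    apply Fin.ext; simp; omega
  rw [e] at this
  rw [this]; rfl

lemma DSum_assoc (α β γ : PermSig) : DSum (DSum α β) γ = DSum α (DSum β γ) := by
  obtain ⟨a, α⟩ := α
  obtain ⟨b, β⟩ := β
  obtain ⟨c, γ⟩ := γ
  refine permSig_ext (Nat.add_assoc _ _ _) fun i hi hi' => ?_
  replace hi : i < a + b + c := hi
  replace hi' : i < a + (b + c) := hi'
  change ((dsum (dsum α β) γ) ⟨i, hi⟩ : ℕ) = (dsum α (dsum β γ)) ⟨i, hi'⟩
  by_cases h1 : i < a
  · rw [dsum_val_lt _ _ i hi (by omega), dsum_val_lt _ _ i _ h1, dsum_val_lt _ _ i _ h1]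
  · rw [dsum_val_ge α _ i hi' h1]
    by_cases h2 : i < a + b
    · rw [dsum_val_lt _ _ i hi h2, dsum_val_ge _ _ i h2 h1, dsum_val_lt _ _ _ _ (by omega)]
    · rw [dsum_val_ge _ _ i hi h2, dsum_val_ge _ _ _ _ (by omega), Nat.add_assoc]
      congr 4
      apply Fin.ext
      simp only
      omega

lemma iota_DSum (α : PermSig) : DSum (iotaSig 0) α = α := by
  obtain ⟨a, α⟩ := α
  refine permSig_ext (Nat.zero_add _) fun i hi hi' => ?_
  replace hi : i < 0 + a := hi
  replace hi' : i < a := hi'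
  change ((dsum (1 : Equiv.Perm (Fin 0)) α) ⟨i, hi⟩ : ℕ) = α ⟨i, hi'⟩
  rw [dsum_val_ge _ _ _ _ (by omega)]
  simp

lemma DSum_iota (α : PermSig) : DSum α (iotaSig 0) = α := by
  obtain ⟨a, α⟩ := α
  refine permSig_ext (Nat.add_zero _) fun i hi hi' => ?_
  replace hi : i < a + 0 := hi
  replace hi' : i < a := hi'
  change ((dsum α (1 : Equiv.Perm (Fin 0))) ⟨i, hi⟩ : ℕ) = α ⟨i, hi'⟩
  rw [dsum_val_lt _ _ _ _ hi']

lemma iota_add (m k : ℕ) : DSum (iotaSig m) (iotaSig k) = iotaSig (m + k) := by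
  refine permSig_ext rfl fun i hi hi' => ?_
  replace hi : i < m + k := hi
  change ((dsum (1 : Equiv.Perm (Fin m)) (1 : Equiv.Perm (Fin k))) ⟨i, hi⟩ : ℕ) = i
  by_cases h : i < m
  · rw [dsum_val_lt _ _ _ _ h]; rfl
  · rw [dsum_val_ge _ _ _ _ h]; simp; omega

/-- growth rate after adding one more avoided pattern -/
noncomputable def GG (Z : Set PermSig) (ξ : PermSig) : ENNReal :=
  growthRate (IkClass 2 ∩ AvClass (insert ξ Z))

lemma GG_iota (Z : Set PermSig) (α β : PermSig) (m : ℕ) :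
    GG Z (DSum α (DSum (iotaSig m) β)) ≤ GG Z (DSum α β) := by
  induction m with
  | zero => rw [iota_DSum]
  | succ m ih =>
    rw [Nat.add_comm m 1, ← iota_add, DSum_assoc]
    exact (step Z α _).trans ih

lemma DSumList_cons (a : PermSig) (l : List PermSig) : DSumList (a :: l) = DSum a (DSumList l) := rfl

lemma GG_pairs (Z : Set PermSig) (pairs : List (PermSig × ℕ)) (γ : PermSig) :
    GG Z (DSum γ (DSumList (pairs.map fun p => DSum p.1 (iotaSig p.2)))) ≤
    GG Z (DSum γ (DSumList (pairs.map Prod.fst))) := by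
  induction pairs generalizing γ with
  | nil => exact le_rfl
  | cons p l ih =>
    rw [List.map_cons, List.map_cons, DSumList_cons, DSumList_cons, DSum_assoc, ← DSum_assoc γ,
      ← DSum_assoc γ]
    exact (GG_iota Z _ _ _).trans (ih _)

lemma GG_red (Z : Set PermSig) {ρ ξ : PermSig} (h : IsRigidReductionOf ρ ξ) : GG Z ξ ≤ GG Z ρ := by
  obtain ⟨m, pairs, -, rfl, rfl⟩ := h
  have h1 := GG_iota Z (iotaSig 0) (DSumList (pairs.map fun p => DSum p.1 (iotaSig p.2))) m
  have h2 := GG_pairs Z pairs (iotaSig 0)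
  rw [iota_DSum, iota_DSum] at h1
  rw [iota_DSum, iota_DSum] at h2
  exact h1.trans h2

lemma Involves.refl (α : PermSig) : Involves α α := ⟨id, strictMono_id, fun _ _ => Iff.rfl⟩

lemma Involves.dsumMono {α α' β β' : PermSig} (h : Involves α α') (h' : Involves β β') :
    Involves (DSum α β) (DSum α' β') := by
  obtain ⟨f, hf⟩ := h
  obtain ⟨g, hg⟩ := h'
  have hid : IsEmbedding (dsum α'.2 β'.2) (dsum α'.2 β'.2) id := ⟨strictMono_id, fun _ _ => Iff.rfl⟩
  exact ⟨_, emb_append ((emb_dsum_left hid).comp hf) ((emb_dsum_right hid).comp hg)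
    (fun i j => emb_dsum_cross hid (f i) (g j))⟩

lemma Involves.iota_left (α : PermSig) (m : ℕ) : Involves α (DSum (iotaSig m) α) := by
  have hid : IsEmbedding (dsum (iotaSig m).2 α.2) (dsum (iotaSig m).2 α.2) id :=
    ⟨strictMono_id, fun _ _ => Iff.rfl⟩
  exact ⟨_, emb_dsum_right hid⟩

lemma Involves.iota_right (α : PermSig) (m : ℕ) : Involves α (DSum α (iotaSig m)) := by
  have hid : IsEmbedding (dsum α.2 (iotaSig m).2) (dsum α.2 (iotaSig m).2) id :=
    ⟨strictMono_id, fun _ _ => Iff.rfl⟩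
  exact ⟨_, emb_dsum_left hid⟩

lemma involves_red {ρ ξ : PermSig} (h : IsRigidReductionOf ρ ξ) : Involves ρ ξ := by
  obtain ⟨m, pairs, -, rfl, rfl⟩ := h
  refine Involves.trans ?_ (Involves.iota_left _ m)
  induction pairs with
  | nil => exact Involves.refl _
  | cons p l ih =>
    rw [List.map_cons, List.map_cons, DSumList_cons, DSumList_cons]
    exact (Involves.iota_right _ _).dsumMono ih

lemma exists_red (N : ℕ) : ∀ π : PermSig, π.1 ≤ N → ∃ ρ, IsRigidReductionOf ρ π := by
  classical
  induction N with
  | zero =>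
    intro π hπ
    refine ⟨_, 0, [], by simp, ?_, rfl⟩
    rw [iota_DSum]
    exact permSig_ext (show π.1 = 0 by omega) (fun i hi => absurd hi (by omega))
  | succ N ih =>
    intro π hπ
    by_cases h0 : π.1 = 0
    · exact ih π (by omega)
    have hex : ∃ k, k ≠ 0 ∧ ∃ α β : PermSig, α.1 = k ∧ π = DSum α β :=
      ⟨π.1, h0, π, iotaSig 0, rfl, (DSum_iota π).symm⟩
    obtain ⟨hk, α, β, hαk, hπαβ⟩ := Nat.find_spec hex
    have hmin := fun m => Nat.find_min hex (m := m)
    generalize Nat.find hex = k at *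
    have hlen : π.1 = α.1 + β.1 := by rw [hπαβ]; rfl
    obtain ⟨ρ, m, pairs, hp, hβ, hρ⟩ := ih β (by omega)
    by_cases h1 : k = 1
    · have hα : α = iotaSig 1 := by
        obtain ⟨a, α⟩ := α
        simp only at hαk
        subst hαk
        subst h1
        exact congrArg (Sigma.mk 1) (Subsingleton.elim _ _)
      refine ⟨ρ, 1 + m, pairs, hp, ?_, hρ⟩
      rw [← iota_add, DSum_assoc, ← hβ, ← hα, hπαβ]
    · refine ⟨DSum α ρ, 0, (α, m) :: pairs, ?_, ?_, ?_⟩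
      · intro p hp'
        rcases List.mem_cons.1 hp' with rfl | hp'
        · refine ⟨⟨by simp only; omega, ?_⟩, by simp only; omega⟩
          intro α1 α2 h1 h2 hα
          simp only at hα
          have hl : α.1 = α1.1 + α2.1 := by rw [hα]; rfl
          refine hmin α1.1 (by omega) ⟨h1, α1, DSum α2 β, rfl, ?_⟩
          rw [hπαβ, hα, DSum_assoc]
        · exact hp p hp'
      · rw [iota_DSum, List.map_cons, DSumList_cons, DSum_assoc, ← hβ, hπαβ]
      · rw [List.map_cons, DSumList_cons, hρ]

lemma finite_le (N : ℕ) : {ρ : PermSig | ρ.1 ≤ N}.Finite := by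
  have : {ρ : PermSig | ρ.1 ≤ N} ⊆
      Set.range (fun x : (Σ n : Fin (N + 1), Equiv.Perm (Fin n)) => (⟨x.1, x.2⟩ : PermSig)) := by
    rintro ⟨n, σ⟩ hn
    exact ⟨⟨⟨n, Nat.lt_succ_of_le hn⟩, σ⟩, rfl⟩
  exact (Set.finite_range _).subset this

lemma Involves.le {α π : PermSig} (h : Involves α π) : α.1 ≤ π.1 := by
  obtain ⟨f, hf⟩ := h
  simpa using Fintype.card_le_of_injective f hf.1.injective

lemma finite_Y (X Y : Set PermSig) (hX : X.Finite)
    (hY : ∀ ρ : PermSig, ρ ∈ Y ↔ ∃ π ∈ X, IsRigidReductionOf ρ π) : Y.Finite := by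
  have : Y ⊆ ⋃ π ∈ X, {ρ : PermSig | ρ.1 ≤ π.1} := by
    intro ρ hρ
    obtain ⟨π, hπ, h⟩ := (hY ρ).1 hρ
    simp only [Set.mem_iUnion]
    exact ⟨π, hπ, (involves_red h).le⟩
  exact (hX.biUnion fun π _ => finite_le π.1).subset this

end Part4

/-- Main theorem: for any finite set `X` of permutations, the classes
`I₂ ∩ Av(X)` and `I₂ ∩ Av(red(X))` have the same growth rate, where
`red(X) = {red(π) : π ∈ X}` is the set of rigid reductions of members of `X`. -/
theorem growthRate_av_eq_av_red (X Y : Set PermSig) (hX : X.Finite)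
    (hY : ∀ ρ : PermSig, ρ ∈ Y ↔ ∃ π ∈ X, IsRigidReductionOf ρ π) :
    growthRate (IkClass 2 ∩ AvClass X) = growthRate (IkClass 2 ∩ AvClass Y) := by
  apply le_antisymm
  · have key : growthRate (IkClass 2 ∩ AvClass X) ≤ growthRate (IkClass 2 ∩ AvClass (X ∪ Y)) := by
      refine Set.Finite.induction_on_subset
        (motive := fun W _ => growthRate (IkClass 2 ∩ AvClass X) ≤
          growthRate (IkClass 2 ∩ AvClass (X ∪ W))) Y (finite_Y X Y hX hY) ?_ ?_
      · rw [Set.union_empty]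
      · intro ρ W hρ hW _ ih
        obtain ⟨ξ, hξ, hred⟩ := (hY ρ).1 hρ
        have h1 := GG_red (X ∪ W) hred
        unfold GG at h1
        rw [Set.insert_eq_of_mem (show ξ ∈ X ∪ W from Or.inl hξ)] at h1
        rw [Set.union_insert]
        exact ih.trans h1
    refine key.trans (growth_mono ?_)
    rintro π ⟨h1, h2⟩
    exact ⟨h1, fun α hα => h2 α (Or.inr hα)⟩
  · apply growth_mono
    rintro π ⟨h1, h2⟩
    refine ⟨h1, fun ξ hξ hinv => ?_⟩
    obtain ⟨ρ, hρ⟩ := exists_red ξ.1 ξ le_rfl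
    exact h2 ρ ((hY ρ).2 ⟨ξ, hξ, hρ⟩) ((involves_red hρ).trans hinv)
end

section
/- Let positive integers k and b be given. There is a positive integer B, depending only on k and b (one may take B = 1 + k(b+1)/2 + b), such that for every π ∈ I₂, either π contains the (k,b)-generic staircase as a pattern, or π is a B-bounded merge of two permutations λ and β where the image of λ contains all elements of π preceding the minimum element of π, and the image of β contains all elements of π smaller than the first element of π. -/
open Filter

/-- `σ` is the `(k,b)`-generic staircase: it has a staircase decomposition into
blocks `P 0, …, P (k-1)`, each increasing of size `b` (listed in order of position
and of value), where each even-to-odd consecutive pair of blocks is arranged left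
to right with interleaved values, each odd-to-even consecutive pair is arranged
bottom to top with interleaved positions, and non-consecutive blocks are totally
separated (later blocks entirely above and to the right). -/
def IsGenericStaircase (k b : ℕ) (σ : PermSig) : Prop :=
  ∃ P : Fin k → Fin b → Fin σ.1,
    (Function.Bijective fun p : Fin k × Fin b => P p.1 p.2) ∧
    (∀ i, StrictMono (P i)) ∧
    (∀ i, StrictMono fun t => σ.2 (P i t)) ∧
    (∀ i j : Fin k, (j : ℕ) = (i : ℕ) + 1 → (i : ℕ) % 2 = 0 →
      (∀ s t, P i s < P j t) ∧
      (∀ t : Fin b, σ.2 (P j t) < σ.2 (P i t)) ∧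
      (∀ s t : Fin b, (s : ℕ) + 1 = (t : ℕ) → σ.2 (P i s) < σ.2 (P j t))) ∧
    (∀ i j : Fin k, (j : ℕ) = (i : ℕ) + 1 → (i : ℕ) % 2 = 1 →
      (∀ s t, σ.2 (P i s) < σ.2 (P j t)) ∧
      (∀ t : Fin b, P i t < P j t) ∧
      (∀ s t : Fin b, (t : ℕ) + 1 = (s : ℕ) → P j t < P i s)) ∧
    (∀ i j : Fin k, (i : ℕ) + 2 ≤ (j : ℕ) →
      ∀ s t, P i s < P j t ∧ σ.2 (P i s) < σ.2 (P j t))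

namespace StairProof

open Classical in
/-- Standardization of a subset of the points of a permutation. -/
theorem exists_pattern {n : ℕ} (π : Equiv.Perm (Fin n)) (S : Set (Fin n)) :
    ∃ (m : ℕ) (σ : Equiv.Perm (Fin m)) (f : Fin m → Fin n),
      IsEmbedding σ π f ∧ Set.range f = S := by
  let A : Finset (Fin n) := S.toFinset
  let C : Finset (Fin n) := A.map π.toEmbedding
  have hC : C.card = A.card := Finset.card_map _
  let e := A.orderIsoOfFin rfl
  let e' := C.orderIsoOfFin hC
  have hmem : ∀ i, π (e i) ∈ C := fun i => by
    have := (e i).2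
    simp only [C, Finset.mem_map]
    exact ⟨e i, this, rfl⟩
  let s : Fin A.card → Fin A.card := fun i => e'.symm ⟨π (e i), hmem i⟩
  have hs : Function.Injective s := by
    intro i j hij
    have := e'.symm.injective hij
    simp only [Subtype.mk.injEq] at this
    exact e.injective (Subtype.ext (π.injective this))
  refine ⟨A.card, Equiv.ofBijective s (Finite.injective_iff_bijective.mp hs),
    fun i => e i, ⟨?_, ?_⟩, ?_⟩
  · intro i j hij
    exact e.strictMono hij
  · intro i j
    simp only [Equiv.ofBijective_apply, s]
    rw [e'.symm.lt_iff_lt]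
    rfl
  · ext x
    constructor
    · rintro ⟨i, rfl⟩
      have h := (e i).2
      exact Set.mem_toFinset.1 h
    · intro hx
      have hx' : x ∈ A := by simpa [A] using hx
      exact ⟨e.symm ⟨x, hx'⟩, by simp⟩

/-- A configuration of points of `π` in the shape of a generic staircase gives an
involved generic staircase. -/
theorem staircase_of_points {n k b : ℕ} (π : Equiv.Perm (Fin n)) (Q : Fin k → Fin b → Fin n)
    (h1 : ∀ i, StrictMono (Q i))
    (h2 : ∀ i, StrictMono fun t => π (Q i t))
    (h3 : ∀ i j : Fin k, (j : ℕ) = (i : ℕ) + 1 → (i : ℕ) % 2 = 0 →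
      (∀ s t, Q i s < Q j t) ∧
      (∀ t : Fin b, π (Q j t) < π (Q i t)) ∧
      (∀ s t : Fin b, (s : ℕ) + 1 = (t : ℕ) → π (Q i s) < π (Q j t)))
    (h4 : ∀ i j : Fin k, (j : ℕ) = (i : ℕ) + 1 → (i : ℕ) % 2 = 1 →
      (∀ s t, π (Q i s) < π (Q j t)) ∧
      (∀ t : Fin b, Q i t < Q j t) ∧
      (∀ s t : Fin b, (t : ℕ) + 1 = (s : ℕ) → Q j t < Q i s))
    (h5 : ∀ i j : Fin k, (i : ℕ) + 2 ≤ (j : ℕ) →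
      ∀ s t, Q i s < Q j t ∧ π (Q i s) < π (Q j t)) :
    ∃ σ : PermSig, IsGenericStaircase k b σ ∧ Involves σ ⟨n, π⟩ := by
  obtain ⟨m, σ, f, hf, hr⟩ := exists_pattern π (Set.range fun p : Fin k × Fin b => Q p.1 p.2)
  have hP : ∀ i t, ∃ y, f y = Q i t := by
    intro i t
    have : Q i t ∈ Set.range f := by rw [hr]; exact ⟨(i, t), rfl⟩
    exact this
  choose P hP using hP
  have hpos : ∀ i s j t, P i s < P j t ↔ Q i s < Q j t := by
    intro i s j t
    rw [← hP, ← hP, hf.1.lt_iff_lt]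
  have hval : ∀ i s j t, σ (P i s) < σ (P j t) ↔ π (Q i s) < π (Q j t) := by
    intro i s j t
    rw [hf.2, hP, hP]
  have hne : ∀ i j : Fin k, (i : ℕ) < j → ∀ s t, Q i s ≠ Q j t := by
    intro i j hij s t he
    rcases Nat.lt_or_ge (i + 1) j with h | h
    · exact absurd he (h5 i j h s t).1.ne
    · have hj : (j : ℕ) = i + 1 := by omega
      rcases Nat.mod_two_eq_zero_or_one i with h | h
      · exact absurd he ((h3 i j hj h).1 s t).ne
      · have := (h4 i j hj h).1 s t
        rw [he] at this
        exact absurd this (lt_irrefl _)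
  refine ⟨⟨m, σ⟩, ⟨P, ⟨?_, ?_⟩, ?_, ?_, ?_, ?_, ?_⟩, ⟨f, hf⟩⟩
  · rintro ⟨i, s⟩ ⟨j, t⟩ he
    simp only at he
    have hQ : Q i s = Q j t := by rw [← hP, ← hP, he]
    rcases lt_trichotomy (i : ℕ) j with h | h | h
    · exact absurd hQ (hne i j h s t)
    · have : i = j := Fin.ext h
      subst this
      rw [(h1 i).injective hQ]
    · exact absurd hQ.symm (hne j i h t s)
  · intro y
    have : f y ∈ Set.range f := ⟨y, rfl⟩
    rw [hr] at this
    obtain ⟨⟨i, t⟩, h⟩ := this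
    refine ⟨(i, t), hf.1.injective ?_⟩
    rw [hP]; exact h
  · intro i s t h; rw [hpos]; exact h1 i h
  · intro i s t h; exact (hval _ _ _ _).2 (h2 i h)
  · intro i j hj hi
    simpa only [hpos, hval] using h3 i j hj hi
  · intro i j hj hi
    simpa only [hpos, hval] using h4 i j hj hi
  · intro i j hj
    simpa only [hpos, hval] using h5 i j hj

/-- The number of changes of a set determined by threshold counts. -/
theorem posChanges_le {n : ℕ} (T : List ℕ) (S : Set (Fin n))
    (hS : ∀ c d : Fin n, T.countP (fun θ => decide (θ ≤ (c : ℕ))) =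
      T.countP (fun θ => decide (θ ≤ (d : ℕ))) → (c ∈ S ↔ d ∈ S)) :
    posChanges S ≤ T.length := by
  classical
  unfold posChanges
  calc _ ≤ (↑(T.toFinset) : Set ℕ).ncard := by
        refine Set.ncard_le_ncard_of_injOn (fun c => (c : ℕ) + 1) ?_ ?_ (Finset.finite_toSet _)
        · rintro c ⟨h, hc⟩
          by_contra hn
          apply hc
          apply hS
          apply List.countP_congr
          intro θ hθ
          have : θ ≠ (c : ℕ) + 1 := by
            rintro rfl
            exact hn (by simpa using hθ)
          simp only [decide_eq_true_eq]
          omega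
        · intro a _ c _ h
          simp only at h
          exact Fin.ext (by omega)
    _ = T.toFinset.card := Set.ncard_coe_finset _
    _ ≤ T.length := List.toFinset_card_le T

/-- Points of `π` that are left-to-right maxima. -/
def IsUp {n : ℕ} (π : Equiv.Perm (Fin n)) (z : Fin n) : Prop := ∀ y, y < z → π y < π z

/-- The chain (left-to-right maxima or the others) of parity `i`. -/
def InCh {n : ℕ} (π : Equiv.Perm (Fin n)) (i : ℕ) (z : Fin n) : Prop := i % 2 = 0 ↔ IsUp π z

/-- Value (for even `j`) or position (for odd `j`) of a point. -/
def key {n : ℕ} (π : Equiv.Perm (Fin n)) (j : ℕ) (z : Fin n) : ℕ :=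
  if j % 2 = 0 then (π z : ℕ) else (z : ℕ)

/-- No decreasing subsequence of length three. -/
def No321 {n : ℕ} (π : Equiv.Perm (Fin n)) : Prop :=
  ∀ x y z : Fin n, x < y → y < z → π y < π x → π z < π y → False

theorem key_inj {n : ℕ} (π : Equiv.Perm (Fin n)) (j : ℕ) {y z : Fin n}
    (h : key π j y = key π j z) : y = z := by
  unfold key at h
  split_ifs at h
  · exact π.injective (Fin.ext h)
  · exact Fin.ext h

theorem key_congr {n : ℕ} (π : Equiv.Perm (Fin n)) {i j : ℕ} (h : i % 2 = j % 2) (z : Fin n) :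
    key π i z = key π j z := by
  unfold key; rw [h]

theorem inCh_congr {n : ℕ} (π : Equiv.Perm (Fin n)) {i j : ℕ} (h : i % 2 = j % 2) (z : Fin n) :
    InCh π i z ↔ InCh π j z := by
  unfold InCh; rw [h]

theorem inCh_or {n : ℕ} (π : Equiv.Perm (Fin n)) (i : ℕ) (z : Fin n) :
    InCh π i z ∨ InCh π (i + 1) z := by
  unfold InCh
  by_cases h : IsUp π z
  · simp only [h, iff_true]; omega
  · simp only [h, iff_false]; omega

theorem inCh_not {n : ℕ} (π : Equiv.Perm (Fin n)) (i : ℕ) (z : Fin n)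
    (h : InCh π i z) (h' : InCh π (i + 1) z) : False := by
  unfold InCh at *
  by_cases hz : IsUp π z
  · simp only [hz, iff_true] at h h'; omega
  · simp only [hz, iff_false] at h h'; omega

theorem lt_val {n : ℕ} {π : Equiv.Perm (Fin n)} (hp : No321 π) {i : ℕ} {y z : Fin n}
    (hy : InCh π i y) (hz : InCh π i z) (h : y < z) : π y < π z := by
  unfold InCh at hy hz
  by_cases hi : i % 2 = 0
  · exact (hz.1 hi) y h
  · have : ¬ IsUp π y := fun h => hi (hy.2 h)
    unfold IsUp at this
    push Not at this
    obtain ⟨w, hw, hwy⟩ := this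
    by_contra hc
    have h1 : π z < π y := lt_of_le_of_ne (not_lt.1 hc) (fun e => h.ne (π.injective e).symm)
    have h2 : π y < π w := lt_of_le_of_ne hwy (fun e => hw.ne (π.injective e).symm)
    exact hp w y z hw h h2 h1

theorem val_lt_iff {n : ℕ} {π : Equiv.Perm (Fin n)} (hp : No321 π) {i : ℕ} {y z : Fin n}
    (hy : InCh π i y) (hz : InCh π i z) : π y < π z ↔ y < z := by
  constructor
  · intro h
    by_contra hc
    rcases (not_lt.1 hc).lt_or_eq with h' | h'
    · exact absurd h (lt_val hp hz hy h').not_gt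
    · rw [h'] at h; exact lt_irrefl _ h
  · exact lt_val hp hy hz

theorem key_lt {n : ℕ} {π : Equiv.Perm (Fin n)} (hp : No321 π) {i : ℕ} {y z : Fin n}
    (hy : InCh π i y) (hz : InCh π i z) (j j' : ℕ) (h : key π j y < key π j z) :
    key π j' y < key π j' z := by
  have := val_lt_iff hp hy hz
  unfold key at *
  split_ifs at * <;> simp only [Fin.val_fin_lt] at * <;> tauto

/-- Points of chain `c` coming after some point of `X` with respect to `key j`. -/
def after {n : ℕ} (π : Equiv.Perm (Fin n)) (j c : ℕ) (X : Set (Fin n)) : Set (Fin n) :=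
  {z | InCh π c z ∧ ∃ y ∈ X, key π j y < key π j z}

/-- The greedy up-sets. -/
def AX {n : ℕ} (π : Equiv.Perm (Fin n)) : ℕ → ℕ → Set (Fin n)
  | 0, 0 => {z | InCh π 0 z}
  | 0, i + 1 => after π i (i + 1) (AX π 0 i)
  | t + 1, 0 => after π 0 0 (AX π t 1)
  | t + 1, i + 1 => after π i (i + 1) (AX π (t + 1) i) ∩ after π (i + 1) (i + 1) (AX π t (i + 2))
termination_by t i => (t, i)

/-- The up-sets bounding the columns from above. -/
def DX {n : ℕ} (π : Equiv.Perm (Fin n)) : ℕ → Set (Fin n)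
  | 0 => {z | InCh π 1 z}
  | i + 1 => after π (i + 1) i (DX π i)

/-- An up-set of the chain `c`. -/
def UpSet {n : ℕ} (π : Equiv.Perm (Fin n)) (c : ℕ) (X : Set (Fin n)) : Prop :=
  (∀ z ∈ X, InCh π c z) ∧
    ∀ y ∈ X, ∀ z, InCh π c z → ∀ j, key π j y ≤ key π j z → z ∈ X

theorem upSet_after {n : ℕ} {π : Equiv.Perm (Fin n)} (hp : No321 π) (j c : ℕ)
    (X : Set (Fin n)) : UpSet π c (after π j c X) := by
  refine ⟨fun z hz => hz.1, ?_⟩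
  rintro y ⟨hy, w, hw, hwy⟩ z hz j' hyz
  refine ⟨hz, w, hw, lt_of_lt_of_le hwy ?_⟩
  rcases hyz.lt_or_eq with h | h
  · exact (key_lt hp hy hz j' j h).le
  · rw [key_inj π j' h]

theorem upSet_inter {n : ℕ} {π : Equiv.Perm (Fin n)} {c : ℕ} {X Y : Set (Fin n)}
    (hX : UpSet π c X) (hY : UpSet π c Y) : UpSet π c (X ∩ Y) :=
  ⟨fun z hz => hX.1 z hz.1, fun y hy z hz j h => ⟨hX.2 y hy.1 z hz j h, hY.2 y hy.2 z hz j h⟩⟩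

theorem upSet_all {n : ℕ} (π : Equiv.Perm (Fin n)) (c : ℕ) : UpSet π c {z | InCh π c z} :=
  ⟨fun _ hz => hz, fun _ _ _ hz _ _ => hz⟩

theorem upSet_total {n : ℕ} {π : Equiv.Perm (Fin n)} {c : ℕ} {X Y : Set (Fin n)}
    (hX : UpSet π c X) (hY : UpSet π c Y) : X ⊆ Y ∨ Y ⊆ X := by
  by_contra hc
  push Not at hc
  obtain ⟨x, hx, hxY⟩ := Set.not_subset.1 hc.1
  obtain ⟨y, hy, hyX⟩ := Set.not_subset.1 hc.2
  rcases le_total (key π 0 x) (key π 0 y) with h | h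
  · exact hyX (hX.2 x hx y (hY.1 y hy) 0 h)
  · exact hxY (hY.2 y hy x (hX.1 x hx) 0 h)

theorem upSet_AX {n : ℕ} {π : Equiv.Perm (Fin n)} (hp : No321 π) (t i : ℕ) :
    UpSet π i (AX π t i) := by
  cases t <;> cases i <;> rw [AX]
  · exact upSet_all π 0
  · exact upSet_after hp _ _ _
  · exact upSet_after hp _ _ _
  · exact upSet_inter (upSet_after hp _ _ _) (upSet_after hp _ _ _)

theorem upSet_DX {n : ℕ} {π : Equiv.Perm (Fin n)} (hp : No321 π) (i : ℕ) :
    UpSet π (i + 1) (DX π i) := by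
  cases i with
  | zero => exact upSet_all π 1
  | succ i =>
    rw [DX]
    have := upSet_after hp (i + 1) i (DX π i)
    have hc : ∀ z, InCh π i z ↔ InCh π (i + 1 + 1) z := fun z => inCh_congr π (by omega) z
    refine ⟨fun z hz => (hc z).1 (this.1 z hz), fun y hy z hz => this.2 y hy z ((hc z).2 hz)⟩

/-- Admissible thresholds. -/
def Adm {n : ℕ} (π : Equiv.Perm (Fin n)) (j θ : ℕ) : Prop :=
  (j % 2 = 0 → ∀ x z : Fin n, (∀ y, x ≤ y) → π z < π x → (π z : ℕ) < θ) ∧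
  (j % 2 = 1 → ∀ x z : Fin n, (∀ y, π x ≤ π y) → z < x → (z : ℕ) < θ)

open Classical in
/-- `X` can be reached with at most `m` thresholds. -/
def Good {n : ℕ} (π : Equiv.Perm (Fin n)) (m : ℕ) (X : Set (Fin n)) : Prop :=
  ∃ W : List (ℕ × ℕ), W.length ≤ m ∧ (∀ e ∈ W, Adm π e.1 e.2) ∧
    ∀ z, Even (W.countP (fun e => decide (e.2 ≤ key π e.1 z)) +
      (if IsUp π z then 1 else 0) + (if z ∈ X then 1 else 0))

theorem Good.mono {n : ℕ} {π : Equiv.Perm (Fin n)} {m m' : ℕ} {X : Set (Fin n)}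
    (h : Good π m X) (hm : m ≤ m') : Good π m' X := by
  obtain ⟨W, h1, h2⟩ := h
  exact ⟨W, h1.trans hm, h2⟩

theorem Good.step {n : ℕ} {π : Equiv.Perm (Fin n)} {m : ℕ} {X Y : Set (Fin n)}
    (h : Good π m X) (j θ : ℕ) (ha : Adm π j θ)
    (hd : ∀ z, z ∈ X → z ∈ Y → False)
    (hXY : ∀ z, θ ≤ key π j z ↔ z ∈ X ∨ z ∈ Y) : Good π (m + 1) Y := by
  classical
  obtain ⟨W, h1, h2, h3⟩ := h
  refine ⟨(j, θ) :: W, by simpa using h1, ?_, ?_⟩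
  · intro e he
    rcases List.mem_cons.1 he with rfl | he
    · exact ha
    · exact h2 e he
  · intro z
    have := h3 z
    rw [List.countP_cons]
    have e1 := hXY z
    have e2 := hd z
    simp only [decide_eq_true_eq, e1]
    by_cases hx : z ∈ X <;> by_cases hy : z ∈ Y
    · exact (e2 hx hy).elim
    all_goals
      simp only [hx, hy, if_true, if_false, or_true, or_false] at this ⊢
      rw [Nat.even_iff] at *
      omega

theorem align {n : ℕ} {π : Equiv.Perm (Fin n)} {c c' : ℕ} (hc : c' % 2 = (c + 1) % 2)
    {X : Set (Fin n)} (hX : UpSet π c X) (hne : X.Nonempty) (j : ℕ) :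
    ∃ y ∈ X, ∀ z, key π j y ≤ key π j z ↔ z ∈ X ∨ z ∈ after π j c' X := by
  obtain ⟨y, hy, hmin⟩ := Set.exists_min_image X (key π j) (Set.toFinite X) hne
  refine ⟨y, hy, fun z => ⟨fun h => ?_, ?_⟩⟩
  · rcases inCh_or π c z with hz | hz
    · exact Or.inl (hX.2 y hy z hz j h)
    · right
      refine ⟨(inCh_congr π hc z).2 hz, y, hy, lt_of_le_of_ne h fun e => ?_⟩
      have := key_inj π j e
      subst this
      exact inCh_not π c y (hX.1 y hy) hz
  · rintro (h | ⟨_, w, hw, hwz⟩)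
    · exact hmin z h
    · exact (hmin w hw).trans hwz.le

theorem disj_after {n : ℕ} {π : Equiv.Perm (Fin n)} {c c' : ℕ} (hc : c' % 2 = (c + 1) % 2)
    {X : Set (Fin n)} (hX : UpSet π c X) (j : ℕ) (z : Fin n) (h : z ∈ X)
    (h' : z ∈ after π j c' X) : False :=
  inCh_not π c z (hX.1 z h) ((inCh_congr π hc z).1 h'.1)

theorem after_empty {n : ℕ} (π : Equiv.Perm (Fin n)) (j c : ℕ) : after π j c ∅ = ∅ := by
  ext z; simp [after]

theorem Good.fwd {n : ℕ} {π : Equiv.Perm (Fin n)} {m c c' : ℕ} (hc : c' % 2 = (c + 1) % 2)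
    {X : Set (Fin n)} (hX : UpSet π c X) (j : ℕ) (ha : ∀ y ∈ X, Adm π j (key π j y))
    (h : Good π m X) : Good π (m + 1) (after π j c' X) := by
  rcases X.eq_empty_or_nonempty with rfl | hne
  · rw [after_empty]; exact h.mono (by omega)
  · obtain ⟨y, hy, hal⟩ := align hc hX hne j
    exact h.step j _ (ha y hy) (disj_after hc hX j) hal

theorem Good.bwd {n : ℕ} {π : Equiv.Perm (Fin n)} {m c c' : ℕ} (hc : c' % 2 = (c + 1) % 2)
    {X : Set (Fin n)} (hX : UpSet π c X) (j : ℕ) (ha : ∀ y ∈ X, Adm π j (key π j y))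
    (h : Good π m (after π j c' X)) : Good π (m + 1) X := by
  rcases X.eq_empty_or_nonempty with rfl | hne
  · rw [after_empty] at h; exact h.mono (by omega)
  · obtain ⟨y, hy, hal⟩ := align hc hX hne j
    exact h.step j _ (ha y hy) (fun z h1 h2 => disj_after hc hX j z h2 h1)
      (fun z => (hal z).trans or_comm)


theorem Adm.mono {n : ℕ} {π : Equiv.Perm (Fin n)} {j θ θ' : ℕ} (h : Adm π j θ) (hθ : θ ≤ θ') :
    Adm π j θ' :=
  ⟨fun hj x z hx hz => (h.1 hj x z hx hz).trans_le hθ,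
    fun hj x z hx hz => (h.2 hj x z hx hz).trans_le hθ⟩

theorem adm_up {n : ℕ} {π : Equiv.Perm (Fin n)} {j : ℕ} {y : Fin n} (hj : j % 2 = 0)
    (hy : IsUp π y) : Adm π j (key π j y) := by
  refine ⟨fun _ x z hx hz => ?_, fun h => by omega⟩
  unfold key
  rw [if_pos hj]
  rcases (hx y).lt_or_eq with h | h
  · exact lt_trans hz (hy x h)
  · subst h; exact hz

theorem adm_lo {n : ℕ} {π : Equiv.Perm (Fin n)} (hp : No321 π) {j : ℕ} {y : Fin n}
    (hj : j % 2 = 1) (hy : ¬ IsUp π y) : Adm π j (key π j y) := by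
  refine ⟨fun h => by omega, fun _ x z hx hz => ?_⟩
  unfold key
  rw [if_neg (by omega)]
  refine lt_of_lt_of_le hz ?_
  by_contra hc
  have hyx : y < x := not_le.1 hc
  unfold IsUp at hy
  push Not at hy
  obtain ⟨w, hw, hwy⟩ := hy
  refine hp w y x hw hyx ?_ ?_
  · exact lt_of_le_of_ne hwy (fun e => hw.ne (π.injective e).symm)
  · exact lt_of_le_of_ne (hx y) (fun e => hyx.ne (π.injective e).symm)

theorem AX_prev {n : ℕ} {π : Equiv.Perm (Fin n)} {t i : ℕ} {z : Fin n}
    (hz : z ∈ AX π t (i + 1)) : ∃ y ∈ AX π t i, key π i y < key π i z := by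
  cases t <;> rw [AX] at hz
  · exact hz.2
  · exact hz.1.2

theorem AX_diag {n : ℕ} {π : Equiv.Perm (Fin n)} {t i : ℕ} {z : Fin n}
    (hz : z ∈ AX π (t + 1) i) : ∃ y ∈ AX π t (i + 1), key π i y < key π i z := by
  cases i <;> rw [AX] at hz
  · exact hz.2
  · exact hz.2.2

theorem adm_AX {n : ℕ} {π : Equiv.Perm (Fin n)} (hp : No321 π) {t i j : ℕ} {y : Fin n}
    (hy : y ∈ AX π t i) (hj : j % 2 = 0 ∨ 1 ≤ i) : Adm π j (key π j y) := by
  have hc := (upSet_AX hp t i).1 y hy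
  unfold InCh at hc
  rcases Nat.mod_two_eq_zero_or_one j with hj0 | hj1
  · rcases Nat.mod_two_eq_zero_or_one i with hi0 | hi1
    · exact adm_up hj0 (hc.1 hi0)
    · obtain ⟨i, rfl⟩ : ∃ i', i = i' + 1 := ⟨i - 1, by omega⟩
      obtain ⟨w, hw, hwy⟩ := AX_prev hy
      have hcw := (upSet_AX hp t i).1 w hw
      unfold InCh at hcw
      rw [key_congr π (show i % 2 = j % 2 by omega), key_congr π (show i % 2 = j % 2 by omega)] at hwy
      exact (adm_up hj0 (hcw.1 (by omega))).mono hwy.le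
  · rcases Nat.mod_two_eq_zero_or_one i with hi0 | hi1
    · obtain ⟨i, rfl⟩ : ∃ i', i = i' + 1 := ⟨i - 1, by omega⟩
      obtain ⟨w, hw, hwy⟩ := AX_prev hy
      have hcw := (upSet_AX hp t i).1 w hw
      unfold InCh at hcw
      rw [key_congr π (show i % 2 = j % 2 by omega), key_congr π (show i % 2 = j % 2 by omega)] at hwy
      exact (adm_lo hp hj1 (fun h => by have := hcw.2 h; omega)).mono hwy.le
    · exact adm_lo hp hj1 (fun h => by have := hc.2 h; omega)

theorem adm_DX {n : ℕ} {π : Equiv.Perm (Fin n)} (hp : No321 π) {i : ℕ} {y : Fin n}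
    (hy : y ∈ DX π i) : Adm π (i + 1) (key π (i + 1) y) := by
  have hc := (upSet_DX hp i).1 y hy
  unfold InCh at hc
  rcases Nat.mod_two_eq_zero_or_one (i + 1) with hj0 | hj1
  · exact adm_up hj0 (hc.1 hj0)
  · exact adm_lo hp hj1 (fun h => by have := hc.2 h; omega)

theorem good_AX {n : ℕ} {π : Equiv.Perm (Fin n)} (hp : No321 π) (t i : ℕ) :
    Good π (2 * t + i) (AX π t i) := by
  induction t generalizing i with
  | zero =>
    induction i with
    | zero =>
      refine ⟨[], by simp, by simp, ?_⟩
      intro z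
      rw [AX]
      simp only [InCh, Set.mem_ofPred_eq, List.countP_nil]
      by_cases h : IsUp π z <;> simp [h]
    | succ i ih =>
      rw [AX]
      refine (ih.fwd (c := i) (c' := i + 1) rfl (upSet_AX hp 0 i) i
        fun y hy => adm_AX hp hy (by omega)).mono (by omega)
  | succ t iht =>
    induction i with
    | zero =>
      rw [AX]
      exact ((iht 1).fwd (c := 1) (c' := 0) rfl (upSet_AX hp t 1) 0
        fun y hy => adm_AX hp hy (by omega)).mono (by omega)
    | succ i ih =>
      have g1 := (ih.fwd (c := i) (c' := i + 1) rfl (upSet_AX hp (t + 1) i) i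
        fun y hy => adm_AX hp hy (by omega))
      have g2 := ((iht (i + 2)).fwd (c := i + 2) (c' := i + 1) (by omega) (upSet_AX hp t (i + 2))
        (i + 1) fun y hy => adm_AX hp hy (by omega))
      rw [AX]
      rcases upSet_total (upSet_after hp i (i + 1) (AX π (t + 1) i))
        (upSet_after hp (i + 1) (i + 1) (AX π t (i + 2))) with h | h
      · rw [Set.inter_eq_left.2 h]; exact g1.mono (by omega)
      · rw [Set.inter_eq_right.2 h]; exact g2.mono (by omega)

theorem good_DX {n : ℕ} {π : Equiv.Perm (Fin n)} (hp : No321 π) (i m : ℕ)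
    (h : Good π m (DX π i)) : Good π (m + i) (DX π 0) := by
  induction i generalizing m with
  | zero => exact h
  | succ i ih =>
    rw [DX] at h
    exact (ih (m + 1) (h.bwd (c := i + 1) (c' := i) (by omega) (upSet_DX hp i) (i + 1)
      fun y hy => adm_DX hp hy)).mono (by omega)

theorem crossing {n : ℕ} {π : Equiv.Perm (Fin n)} (hp : No321 π) (z0 : Fin n)
    (hz0 : ∀ y, z0 ≤ y) (h : ℕ) (hnb : ¬ Good π (2 * h - 1) (DX π 0)) (t i : ℕ)
    (hti : t + i < h) : ¬ AX π t i ⊆ DX π (i + 1) := by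
  have fin : ∀ t i, t + i < h → AX π t i ⊆ DX π (i + 1) → DX π (i + 1) ⊆ AX π t i → False := by
    intro t i hti h1 h2
    have := good_AX hp t i
    rw [h1.antisymm h2] at this
    exact hnb ((good_DX hp _ _ this).mono (by omega))
  have L1 : ∀ t i, ¬ AX π t i ⊆ DX π (i + 1) →
      DX π (i + 2) ⊆ after π i (i + 1) (AX π t i) := by
    intro t i hn z hz
    have hu : UpSet π i (DX π (i + 1)) := by
      have := upSet_after hp (i + 1) i (DX π i)
      rw [DX]; exact this
    have hs := (upSet_total (upSet_AX hp t i) hu).resolve_left hn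
    rw [DX] at hz
    obtain ⟨hc, y, hy, hyz⟩ := hz
    refine ⟨hc, y, hs hy, ?_⟩
    rw [key_congr π (show i % 2 = (i + 1 + 1) % 2 by omega),
      key_congr π (show i % 2 = (i + 1 + 1) % 2 by omega)]
    exact hyz
  have L2 : ∀ t i, ¬ AX π t (i + 1) ⊆ DX π (i + 2) →
      DX π (i + 1) ⊆ after π i i (AX π t (i + 1)) := by
    intro t i hn y hy
    obtain ⟨x, hx, hxn⟩ := Set.not_subset.1 hn
    have hyc : InCh π i y := by rw [DX] at hy; exact hy.1
    have hxc := (upSet_AX hp t (i + 1)).1 x hx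
    refine ⟨hyc, x, hx, ?_⟩
    rw [key_congr π (show i % 2 = (i + 1 + 1) % 2 by omega),
      key_congr π (show i % 2 = (i + 1 + 1) % 2 by omega)]
    by_contra hc
    apply hxn
    rw [DX]
    refine ⟨hxc, y, hy, lt_of_le_of_ne (not_lt.1 hc) fun e => ?_⟩
    have := key_inj π _ e
    subst this
    exact inCh_not π i y hyc hxc
  induction t generalizing i with
  | zero =>
    induction i with
    | zero =>
      intro hs
      have : z0 ∈ AX π 0 0 := by
        rw [AX]
        exact ⟨fun _ y hy => absurd hy (hz0 y).not_gt, fun _ => rfl⟩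
      have := hs this
      rw [DX] at this
      obtain ⟨_, y, _, hy⟩ := this
      unfold key at hy
      simp only [Nat.zero_add] at hy
      exact absurd hy (not_lt.2 (hz0 y))
    | succ i ih =>
      intro hs
      refine fin 0 (i + 1) hti hs ?_
      conv_rhs => rw [AX]
      exact L1 0 i (ih (by omega))
  | succ t iht =>
    induction i with
    | zero =>
      intro hs
      refine fin (t + 1) 0 hti hs ?_
      conv_rhs => rw [AX]
      exact L2 t 0 (iht 1 (by omega))
    | succ i ih =>
      intro hs
      refine fin (t + 1) (i + 1) hti hs ?_
      conv_rhs => rw [AX]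
      exact Set.subset_inter (L1 (t + 1) i (ih (by omega))) (L2 t (i + 1) (iht (i + 2) (by omega)))

/-- From thresholds to a merge. -/
theorem merge_of_good {n : ℕ} {π : Equiv.Perm (Fin n)} {m : ℕ} (h : Good π m (DX π 0)) :
    ∃ (a c : ℕ) (lam : Equiv.Perm (Fin a)) (bet : Equiv.Perm (Fin c))
            (f : Fin a → Fin n) (g : Fin c → Fin n),
          IsMergeVia lam bet π f g ∧
          typeChanges π (Set.range f) ≤ m ∧
          (∀ x z : Fin n, (∀ y, π x ≤ π y) → z < x → ∃ i, f i = z) ∧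
          (∀ x z : Fin n, (∀ y, x ≤ y) → π z < π x → ∃ j, g j = z) := by
  classical
  obtain ⟨W, hlen, hadm, hW⟩ := h
  let V : List ℕ := (W.filter fun e => decide (e.1 % 2 = 0)).map Prod.snd
  let P : List ℕ := (W.filter fun e => !decide (e.1 % 2 = 0)).map Prod.snd
  have hVP : V.length + P.length = W.length := by
    simp only [V, P, List.length_map]
    have := List.length_eq_length_filter_add (l := W) (fun e => decide (e.1 % 2 = 0))
    omega
  have hcnt : ∀ z : Fin n, W.countP (fun e => decide (e.2 ≤ key π e.1 z)) =
      V.countP (fun θ => decide (θ ≤ (π z : ℕ))) + P.countP (fun θ => decide (θ ≤ (z : ℕ))) := by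
    intro z
    simp only [V, P, List.countP_map, List.countP_filter]
    clear hVP hW hadm hlen V P
    induction W with
    | nil => simp
    | cons e W ih =>
      simp only [Function.comp, key] at ih
      simp only [List.countP_cons, Function.comp, key]
      by_cases he : e.1 % 2 = 0 <;> simp [he] <;> omega
  have hodd : ∀ z : Fin n, Odd (V.countP (fun θ => decide (θ ≤ (π z : ℕ))) +
      P.countP (fun θ => decide (θ ≤ (z : ℕ)))) := by
    intro z
    have := hW z
    rw [hcnt] at this
    have hd : z ∈ DX π 0 ↔ ¬ IsUp π z := by
      rw [DX]; simp [InCh]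
    simp only [hd] at this
    rw [Nat.odd_iff]
    rw [Nat.even_iff] at this
    by_cases hu : IsUp π z <;> simp only [hu, if_true, if_false, not_true, not_false_iff] at this <;> omega
  let S : Set (Fin n) := {z | Even (P.countP (fun θ => decide (θ ≤ (z : ℕ))))}
  have hS1 : ∀ z, z ∈ S ↔ Even (P.countP (fun θ => decide (θ ≤ (z : ℕ)))) := fun z => Iff.rfl
  have hS2 : ∀ z, z ∈ S ↔ Odd (V.countP (fun θ => decide (θ ≤ (π z : ℕ)))) := by
    intro z
    have := hodd z
    rw [hS1]
    rw [Nat.odd_iff] at *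
    rw [Nat.even_iff]
    omega
  obtain ⟨a, lam, f, hf, hfr⟩ := exists_pattern π S
  obtain ⟨c, bet, g, hg, hgr⟩ := exists_pattern π Sᶜ
  have hf' : ∀ x, (∃ i, f i = x) ↔ x ∈ S := fun x => by rw [← hfr]; rfl
  have hg' : ∀ x, (∃ i, g i = x) ↔ x ∉ S := fun x => by
    rw [← Set.mem_compl_iff, ← hgr]; rfl
  refine ⟨a, c, lam, bet, f, g, ⟨hf, hg, fun x => ?_⟩, ?_, ?_, ?_⟩
  · rw [hf', hg', not_not]
  · rw [hfr]
    unfold typeChanges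
    have h1 : posChanges S ≤ P.length := by
      apply posChanges_le
      intro c d hcd
      rw [hS1, hS1, hcd]
    have h2 : posChanges ((fun x => π x) '' S) ≤ V.length := by
      apply posChanges_le
      have him : ∀ c, c ∈ (fun x => π x) '' S ↔ π.symm c ∈ S := by
        intro c
        constructor
        · rintro ⟨x, hx, rfl⟩; simpa using hx
        · intro h; exact ⟨_, h, by simp⟩
      intro c d hcd
      rw [him, him, hS2, hS2, Equiv.apply_symm_apply, Equiv.apply_symm_apply, hcd]
    omega
  · intro x z hx hz
    rw [hf', hS1]
    have : P.countP (fun θ => decide (θ ≤ (z : ℕ))) = 0 := by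
      rw [List.countP_eq_zero]
      intro θ hθ
      simp only [P, List.mem_map, List.mem_filter] at hθ
      obtain ⟨e, ⟨he, he2⟩, rfl⟩ := hθ
      have := (hadm e he).2 (by simpa using he2) x z hx hz
      simpa using this
    rw [this]; exact Even.zero
  · intro x z hx hz
    rw [hg', hS2]
    have : V.countP (fun θ => decide (θ ≤ (π z : ℕ))) = 0 := by
      rw [List.countP_eq_zero]
      intro θ hθ
      simp only [V, List.mem_map, List.mem_filter] at hθ
      obtain ⟨e, ⟨he, he2⟩, rfl⟩ := hθ
      have := (hadm e he).1 (by simpa using he2) x z hx hz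
      simpa using this
    rw [this]; simp

theorem AX_sub_DX {n : ℕ} {π : Equiv.Perm (Fin n)} (hp : No321 π) (t i : ℕ) :
    AX π t (i + 1) ⊆ DX π i := by
  induction i with
  | zero => intro z hz; rw [DX]; exact (upSet_AX hp t 1).1 z hz
  | succ i ih =>
    intro z hz
    obtain ⟨y, hy, hyz⟩ := AX_prev hz
    rw [DX]
    exact ⟨(inCh_congr π (by omega) z).1 ((upSet_AX hp t (i + 1 + 1)).1 z hz), y, ih hy, hyz⟩

/-- A triangular array of points of `π` with the staircase relations. -/
structure Tri {n : ℕ} (π : Equiv.Perm (Fin n)) (h : ℕ) (x : ℕ → ℕ → Fin n) : Prop where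
  r1 : ∀ i s t, s < t → t + i < h → ∀ j, key π j (x i s) < key π j (x i t)
  r2 : ∀ i s t, s ≤ t → t + i + 1 < h → key π i (x i s) < key π i (x (i + 1) t)
  r2' : ∀ i s t, t < s → s + i < h → key π i (x (i + 1) t) < key π i (x i s)
  r3 : ∀ i s t, s + i < h → t + i + 1 < h → key π (i + 1) (x i s) < key π (i + 1) (x (i + 1) t)
  r4 : ∀ i j s t, i + 2 ≤ j → s + i < h → t + j < h → ∀ l, key π l (x i s) < key π l (x j t)

theorem exists_tri {n : ℕ} {π : Equiv.Perm (Fin n)} (hp : No321 π) (z0 : Fin n) (h : ℕ)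
    (hX : ∀ t i, t + i < h → ¬ AX π t i ⊆ DX π (i + 1)) : ∃ x, Tri π h x := by
  have hex : ∀ i t, ∃ y, t + i < h → y ∈ AX π t i ∧ (∀ z ∈ AX π t i, ∀ j, key π j y ≤ key π j z) ∧
      y ∉ DX π (i + 1) := by
    intro i t
    by_cases hti : t + i < h
    · obtain ⟨w, hw, hwn⟩ := Set.not_subset.1 (hX t i hti)
      obtain ⟨y, hy, hmin⟩ := Set.exists_min_image (AX π t i) (key π 0) (Set.toFinite _) ⟨w, hw⟩
      have hmin' : ∀ z ∈ AX π t i, ∀ j, key π j y ≤ key π j z := by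
        intro z hz j
        rcases (hmin z hz).lt_or_eq with hlt | heq
        · exact (key_lt hp ((upSet_AX hp t i).1 y hy) ((upSet_AX hp t i).1 z hz) 0 j hlt).le
        · rw [key_inj π 0 heq]
      refine ⟨y, fun _ => ⟨hy, hmin', fun hyd => hwn ?_⟩⟩
      refine (upSet_DX hp (i + 1)).2 y hyd w ?_ 0 (hmin w hw)
      exact (inCh_congr π (by omega) w).1 ((upSet_AX hp t i).1 w hw)
    · exact ⟨z0, fun h => absurd h hti⟩
  choose x hx using hex
  have hc : ∀ i t, t + i < h → InCh π i (x i t) := fun i t hti =>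
    (upSet_AX hp t i).1 _ (hx i t hti).1
  have r1s : ∀ i t, t + 1 + i < h → ∀ j, key π j (x i t) < key π j (x i (t + 1)) := by
    intro i t hti j
    obtain ⟨y, hy, hy'⟩ := AX_diag (hx i (t + 1) hti).1
    obtain ⟨w, hw, hw'⟩ := AX_prev hy
    have := (hx i t (by omega)).2.1 w hw i
    exact key_lt hp (hc i t (by omega)) (hc i (t + 1) hti) i j (by omega)
  have r1 : ∀ i s t, s < t → t + i < h → ∀ j, key π j (x i s) < key π j (x i t) := by
    intro i s t hst
    induction t, hst using Nat.le_induction with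
    | base => intro hh j; exact r1s i s hh j
    | succ t hst ih =>
      intro hh j
      exact (ih (by omega) j).trans (r1s i t hh j)
  have r1' : ∀ i s t, s ≤ t → t + i < h → ∀ j, key π j (x i s) ≤ key π j (x i t) := by
    intro i s t hst hh j
    rcases hst.lt_or_eq with h1 | h1
    · exact (r1 i s t h1 hh j).le
    · rw [h1]
  have r2 : ∀ i s t, s ≤ t → t + i + 1 < h → key π i (x i s) < key π i (x (i + 1) t) := by
    intro i s t hst hh
    obtain ⟨y, hy, hy'⟩ := AX_prev (hx (i + 1) t (by omega)).1
    have := (hx i t (by omega)).2.1 y hy i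
    have := r1' i s t hst (by omega) i
    omega
  have r3 : ∀ i s t, s + i < h → t + i + 1 < h →
      key π (i + 1) (x i s) < key π (i + 1) (x (i + 1) t) := by
    intro i s t hs ht
    have h1 := AX_sub_DX hp t i (hx (i + 1) t (by omega)).1
    have h2 := (hx i s hs).2.2
    by_contra hcn
    apply h2
    rw [DX]
    refine ⟨hc i s hs, _, h1, lt_of_le_of_ne (not_lt.1 hcn) fun e => ?_⟩
    have := key_inj π _ e
    have h3 := hc (i + 1) t (by omega)
    rw [this] at h3
    exact inCh_not π i _ (hc i s hs) h3
  have r4a : ∀ i s t, s + i < h → t + i + 2 < h → ∀ l,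
      key π l (x i s) < key π l (x (i + 2) t) := by
    intro i s t hs ht l
    have h1 := AX_sub_DX hp t (i + 1) (hx (i + 2) t (by omega)).1
    have h2 := (hx i s hs).2.2
    by_contra hcn
    apply h2
    exact (upSet_DX hp (i + 1)).2 _ h1 _
      ((inCh_congr π (by omega) _).1 (hc i s hs)) l (not_lt.1 hcn)
  have r4 : ∀ d i s t, s + i < h → t + (i + 2 + d) < h → ∀ l,
      key π l (x i s) < key π l (x (i + 2 + d) t) := by
    intro d
    induction d using Nat.strong_induction_on with
    | _ d ih =>
      intro i s t hs ht l
      rcases Nat.lt_or_ge d 2 with hd | hd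
      · interval_cases d
        · exact r4a i s t hs (by omega) l
        · rcases Nat.mod_two_eq_zero_or_one (i + l) with hl | hl
          · have a1 := r4a i s t hs (by omega) l
            have a2 := r2 (i + 2) t t le_rfl (by omega)
            rw [key_congr π (show (i + 2) % 2 = l % 2 by omega),
              key_congr π (show (i + 2) % 2 = l % 2 by omega)] at a2
            exact a1.trans a2
          · have a1 := r3 i s 0 hs (by omega)
            have a2 := r4a (i + 1) 0 t (by omega) (by omega) l
            rw [key_congr π (show (i + 1) % 2 = l % 2 by omega),
              key_congr π (show (i + 1) % 2 = l % 2 by omega)] at a1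
            exact a1.trans a2
      · obtain ⟨e, rfl⟩ : ∃ e, d = e + 2 := ⟨d - 2, by omega⟩
        have a1 := r4a i s 0 hs (by omega) l
        have a2 := ih e (by omega) (i + 2) 0 t (by omega) (by omega) l
        have he : i + 2 + (e + 2) = i + 2 + 2 + e := by ring
        rw [he]
        exact a1.trans a2
  refine ⟨x, r1, r2, ?_, r3, ?_⟩
  · intro i s t hts hs
    obtain ⟨y, hy, hy'⟩ := AX_diag (hx i (t + 1) (by omega)).1
    have := (hx (i + 1) t (by omega)).2.1 y hy i
    have := r1' i (t + 1) s hts hs i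
    omega
  · intro i j s t hij hs ht l
    obtain ⟨d, rfl⟩ := Nat.exists_eq_add_of_le hij
    exact r4 d i s t hs ht l

theorem stair_of_key {n k b : ℕ} (π : Equiv.Perm (Fin n)) (Q : ℕ → ℕ → Fin n)
    (h1 : ∀ i s t, i < k → s < t → t < b → ∀ j, key π j (Q i s) < key π j (Q i t))
    (h2 : ∀ i s t, i + 1 < k → s < b → t < b → key π (i + 1) (Q i s) < key π (i + 1) (Q (i + 1) t))
    (h3 : ∀ i t, i + 1 < k → t < b → i % 2 = 0 → key π i (Q (i + 1) t) < key π i (Q i t))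
    (h3' : ∀ i t, i + 1 < k → t + 1 < b → i % 2 = 0 →
      key π i (Q i t) < key π i (Q (i + 1) (t + 1)))
    (h4 : ∀ i t, i + 1 < k → t < b → i % 2 = 1 → key π i (Q i t) < key π i (Q (i + 1) t))
    (h4' : ∀ i t, i + 1 < k → t + 1 < b → i % 2 = 1 →
      key π i (Q (i + 1) t) < key π i (Q i (t + 1)))
    (h5 : ∀ i j s t, i + 2 ≤ j → j < k → s < b → t < b → ∀ l,
      key π l (Q i s) < key π l (Q j t)) :
    ∃ σ : PermSig, IsGenericStaircase k b σ ∧ Involves σ ⟨n, π⟩ := by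
  have kv : ∀ {i : ℕ}, i % 2 = 0 → ∀ z, key π i z = (π z : ℕ) := fun h z => by
    unfold key; rw [if_pos h]
  have kp : ∀ {i : ℕ}, i % 2 = 1 → ∀ z, key π i z = (z : ℕ) := fun h z => by
    unfold key; rw [if_neg (by omega)]
  refine staircase_of_points π (fun i t => Q i t) ?_ ?_ ?_ ?_ ?_
  · intro i s t hst
    have := h1 i s t i.2 hst t.2 1
    rwa [kp rfl, kp rfl] at this
  · intro i s t hst
    have := h1 i s t i.2 hst t.2 0
    rwa [kv rfl, kv rfl] at this
  · intro i j hij hi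
    have hik : (i : ℕ) + 1 < k := by omega
    rw [hij]
    refine ⟨fun s t => ?_, fun t => ?_, fun s t hst => ?_⟩
    · have := h2 i s t hik s.2 t.2
      rwa [kp (by omega), kp (by omega)] at this
    · have := h3 i t hik t.2 hi
      rwa [kv hi, kv hi] at this
    · have := h3' i s hik (by omega) hi
      rw [hst] at this
      rwa [kv hi, kv hi] at this
  · intro i j hij hi
    have hik : (i : ℕ) + 1 < k := by omega
    rw [hij]
    refine ⟨fun s t => ?_, fun t => ?_, fun s t hst => ?_⟩
    · have := h2 i s t hik s.2 t.2
      rwa [kv (by omega), kv (by omega)] at this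
    · have := h4 i t hik t.2 hi
      rwa [kp hi, kp hi] at this
    · have := h4' i t hik (by omega) hi
      rw [hst] at this
      rwa [kp hi, kp hi] at this
  · intro i j hij s t
    have a := h5 i j s t hij j.2 s.2 t.2
    have a0 := a 0
    have a1 := a 1
    rw [kv rfl, kv rfl] at a0
    rw [kp rfl, kp rfl] at a1
    exact ⟨a1, a0⟩

/-- The general case. -/
theorem stair_gen {n : ℕ} {π : Equiv.Perm (Fin n)} {h : ℕ} {x : ℕ → ℕ → Fin n}
    (T : Tri π h x) (k b : ℕ) (hh : b + k ≤ h + 1) :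
    ∃ σ : PermSig, IsGenericStaircase k b σ ∧ Involves σ ⟨n, π⟩ := by
  refine stair_of_key π (fun i t => x i (t + (k / 2 - (i + 1) / 2))) ?_ ?_ ?_ ?_ ?_ ?_ ?_
  · intro i s t hi hst ht j
    exact T.r1 i _ _ (by omega) (by omega) j
  · intro i s t hi hs ht
    exact T.r3 i _ _ (by omega) (by omega)
  · intro i t hi ht hp
    exact T.r2' i _ _ (by omega) (by omega)
  · intro i t hi ht hp
    exact T.r2 i _ _ (by omega) (by omega)
  · intro i t hi ht hp
    exact T.r2 i _ _ (by omega) (by omega)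
  · intro i t hi ht hp
    exact T.r2' i _ _ (by omega) (by omega)
  · intro i j s t hij hj hs ht l
    exact T.r4 i j _ _ hij (by omega) (by omega) l

/-- A single increasing block. -/
theorem stair_one {n : ℕ} {π : Equiv.Perm (Fin n)} {h : ℕ} {x : ℕ → ℕ → Fin n}
    (T : Tri π h x) (b : ℕ) (hh : b + 2 ≤ 2 * h) :
    ∃ σ : PermSig, IsGenericStaircase 1 b σ ∧ Involves σ ⟨n, π⟩ := by
  refine stair_of_key π (fun _ t => if t < h then x 0 t else x 2 (t - h)) ?_ ?_ ?_ ?_ ?_ ?_ ?_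
  · intro i s t hi hst ht j
    by_cases h1 : t < h
    · simp only [h1, hst.trans h1, if_true]
      exact T.r1 0 s t hst (by omega) j
    · by_cases h2 : s < h
      · simp only [h1, h2, if_true, if_false]
        exact T.r4 0 2 _ _ le_rfl (by omega) (by omega) j
      · simp only [h1, h2, if_false]
        exact T.r1 2 _ _ (by omega) (by omega) j
  all_goals intros; omega

/-- Points of the triangle forming an increasing oscillation. -/
def pt {n : ℕ} (x : ℕ → ℕ → Fin n) (j : ℕ) : Fin n :=
  if j % 3 = 0 then x (j / 3) 1 else if j % 3 = 1 then x (j / 3 + 1) 0 else x (j / 3) 2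

theorem pt0 {n : ℕ} (x : ℕ → ℕ → Fin n) (m : ℕ) : pt x (3 * m) = x m 1 := by
  unfold pt
  rw [if_pos (by omega), show 3 * m / 3 = m by omega]

theorem pt1 {n : ℕ} (x : ℕ → ℕ → Fin n) (m : ℕ) : pt x (3 * m + 1) = x (m + 1) 0 := by
  unfold pt
  rw [if_neg (by omega), if_pos (by omega), show (3 * m + 1) / 3 = m by omega]

theorem pt2 {n : ℕ} (x : ℕ → ℕ → Fin n) (m : ℕ) : pt x (3 * m + 2) = x m 2 := by
  unfold pt
  rw [if_neg (by omega), if_neg (by omega), show (3 * m + 2) / 3 = m by omega]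

theorem key_lt_congr {n : ℕ} {π : Equiv.Perm (Fin n)} {i j : ℕ} {y z : Fin n}
    (hl : key π i y < key π i z) (h : i % 2 = j % 2) : key π j y < key π j z := by
  rwa [key_congr π h, key_congr π h] at hl

theorem pt_cases (j : ℕ) : ∃ m, j = 3 * m ∨ j = 3 * m + 1 ∨ j = 3 * m + 2 :=
  ⟨j / 3, by omega⟩

theorem pt_next {n : ℕ} {π : Equiv.Perm (Fin n)} {h : ℕ} {x : ℕ → ℕ → Fin n}
    (T : Tri π h x) (j : ℕ) (hj : (j + 4) / 3 < h) (hj' : (j + 5) / 3 < h) :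
    (∀ l, l % 2 = j % 2 → key π l (pt x (j + 1)) < key π l (pt x j)) ∧
    (∀ l, l % 2 = (j + 1) % 2 → key π l (pt x j) < key π l (pt x (j + 1))) := by
  obtain ⟨m, rfl | rfl | rfl⟩ := pt_cases j
  · rw [pt0, pt1]
    exact ⟨fun l hl => key_lt_congr (T.r2' m 1 0 (by omega) (by omega)) (by omega),
      fun l hl => key_lt_congr (T.r3 m 1 0 (by omega) (by omega)) (by omega)⟩
  · rw [pt1, show 3 * m + 1 + 1 = 3 * m + 2 by ring, pt2]
    exact ⟨fun l hl => key_lt_congr (T.r3 m 2 0 (by omega) (by omega)) (by omega),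
      fun l hl => key_lt_congr (T.r2' m 2 0 (by omega) (by omega)) (by omega)⟩
  · rw [pt2, show 3 * m + 2 + 1 = 3 * (m + 1) by ring, pt0]
    exact ⟨fun l hl => key_lt_congr (T.r2' m 2 1 (by omega) (by omega)) (by omega),
      fun l hl => key_lt_congr (T.r3 m 2 1 (by omega) (by omega)) (by omega)⟩

theorem pt_two {n : ℕ} {π : Equiv.Perm (Fin n)} {h : ℕ} {x : ℕ → ℕ → Fin n}
    (T : Tri π h x) (j : ℕ) (hj : (j + 5) / 3 < h) (hj' : (j + 6) / 3 < h) (l : ℕ) :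
    key π l (pt x j) < key π l (pt x (j + 2)) := by
  obtain ⟨m, rfl | rfl | rfl⟩ := pt_cases j
  · rw [pt0, pt2]
    exact T.r1 m 1 2 (by omega) (by omega) l
  · rw [pt1, show 3 * m + 1 + 2 = 3 * (m + 1) by ring, pt0]
    exact T.r1 (m + 1) 0 1 (by omega) (by omega) l
  · rw [pt2, show 3 * m + 2 + 2 = 3 * (m + 1) + 1 by ring, pt1]
    exact T.r4 m (m + 2) 2 0 (by omega) (by omega) (by omega) l

theorem pt_three {n : ℕ} {π : Equiv.Perm (Fin n)} {h : ℕ} {x : ℕ → ℕ → Fin n}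
    (T : Tri π h x) (j : ℕ) (hj' : (j + 7) / 3 < h) (l : ℕ) :
    key π l (pt x j) < key π l (pt x (j + 3)) := by
  have aux : ∀ i s, s + i + 1 < h → key π l (x i s) < key π l (x (i + 1) s) := by
    intro i s hs
    rcases Nat.mod_two_eq_zero_or_one (i + l) with hl | hl
    · exact key_lt_congr (T.r2 i s s le_rfl hs) (by omega)
    · exact key_lt_congr (T.r3 i s s (by omega) hs) (by omega)
  obtain ⟨m, rfl | rfl | rfl⟩ := pt_cases j
  · rw [show 3 * m + 3 = 3 * (m + 1) by ring, pt0, pt0]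
    exact aux _ _ (by omega)
  · rw [show 3 * m + 1 + 3 = 3 * (m + 1) + 1 by ring, pt1, pt1]
    exact aux _ _ (by omega)
  · rw [show 3 * m + 2 + 3 = 3 * (m + 1) + 2 by ring, pt2, pt2]
    exact aux _ _ (by omega)

theorem pt_far {n : ℕ} {π : Equiv.Perm (Fin n)} {h : ℕ} {x : ℕ → ℕ → Fin n}
    (T : Tri π h x) (i j : ℕ) (hij : i + 2 ≤ j) (hj : (j + 4) / 3 < h) (l : ℕ) :
    key π l (pt x i) < key π l (pt x j) := by
  obtain ⟨d, rfl⟩ := Nat.exists_eq_add_of_le hij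
  clear hij
  induction d using Nat.strong_induction_on generalizing i with
  | _ d ih =>
    rcases Nat.lt_or_ge d 2 with hd | hd
    · interval_cases d
      · exact pt_two T i (by omega) (by omega) l
      · exact pt_three T i (by omega) l
    · obtain ⟨e, rfl⟩ : ∃ e, d = e + 2 := ⟨d - 2, by omega⟩
      have a := pt_two T i (by omega) (by omega) l
      have c := ih e (by omega) (i + 2) (by omega)
      rw [show i + 2 + (e + 2) = i + 2 + 2 + e by ring]
      exact a.trans c

/-- Blocks of size two. -/
theorem stair_two {n : ℕ} {π : Equiv.Perm (Fin n)} {h : ℕ} {x : ℕ → ℕ → Fin n}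
    (T : Tri π h x) (k : ℕ) (hh : (2 * k + 4) / 3 < h) :
    ∃ σ : PermSig, IsGenericStaircase k 2 σ ∧ Involves σ ⟨n, π⟩ := by
  have nx : ∀ j j', j' = j + 1 → (j' + 4) / 3 < h → ∀ l, l % 2 = j % 2 →
      key π l (pt x j') < key π l (pt x j) := by
    rintro j _ rfl hj l hl
    exact (pt_next T j (by omega) (by omega)).1 l hl
  have nx' : ∀ j j', j' = j + 1 → (j' + 4) / 3 < h → ∀ l, l % 2 = (j + 1) % 2 →
      key π l (pt x j) < key π l (pt x j') := by
    rintro j _ rfl hj l hl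
    exact (pt_next T j (by omega) (by omega)).2 l hl
  refine stair_of_key π (fun i t => pt x (4 * (i / 2) + i % 2 + 2 * t)) ?_ ?_ ?_ ?_ ?_ ?_ ?_
  · intro i s t hi hst ht j
    exact pt_far T _ _ (by omega) (by omega) j
  · intro i s t hi hs ht
    rcases Nat.mod_two_eq_zero_or_one i with hp | hp
    · interval_cases s <;> interval_cases t
      · exact nx' _ _ (by omega) (by omega) _ (by omega)
      · exact pt_far T _ _ (by omega) (by omega) _
      · exact nx _ _ (by omega) (by omega) _ (by omega)
      · exact nx' _ _ (by omega) (by omega) _ (by omega)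
    · interval_cases s <;> interval_cases t
      · exact pt_far T _ _ (by omega) (by omega) _
      · exact pt_far T _ _ (by omega) (by omega) _
      · exact nx' _ _ (by omega) (by omega) _ (by omega)
      · exact pt_far T _ _ (by omega) (by omega) _
  · intro i t hi ht hp
    exact nx _ _ (by omega) (by omega) _ (by omega)
  · intro i t hi ht hp
    exact pt_far T _ _ (by omega) (by omega) _
  · intro i t hi ht hp
    exact pt_far T _ _ (by omega) (by omega) _
  · intro i t hi ht hp
    exact nx _ _ (by omega) (by omega) _ (by omega)
  · intro i j s t hij hj hs ht l
    exact pt_far T _ _ (by omega) (by omega) l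

/-- Blocks of size one. -/
theorem stair_unit {n : ℕ} {π : Equiv.Perm (Fin n)} {h : ℕ} {x : ℕ → ℕ → Fin n}
    (T : Tri π h x) (k : ℕ) (hh : (k + 1) / 2 < h) :
    ∃ σ : PermSig, IsGenericStaircase k 1 σ ∧ Involves σ ⟨n, π⟩ := by
  have nx : ∀ j j', j' = j + 1 → (j' + 4) / 3 < h → ∀ l, l % 2 = j % 2 →
      key π l (pt x j') < key π l (pt x j) := by
    rintro j _ rfl hj l hl
    exact (pt_next T j (by omega) (by omega)).1 l hl
  have nx' : ∀ j j', j' = j + 1 → (j' + 4) / 3 < h → ∀ l, l % 2 = (j + 1) % 2 →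
      key π l (pt x j) < key π l (pt x j') := by
    rintro j _ rfl hj l hl
    exact (pt_next T j (by omega) (by omega)).2 l hl
  refine stair_of_key π (fun i _ => pt x (3 * (i / 2) + (i / 2 + i % 2) % 2)) ?_ ?_ ?_ ?_ ?_ ?_ ?_
  · intro i s t hi hst ht j
    omega
  · intro i s t hi hs ht
    rcases Nat.mod_two_eq_zero_or_one i with hp | hp
    · rcases Nat.mod_two_eq_zero_or_one (i / 2) with hq | hq
      · exact nx' _ _ (by omega) (by omega) _ (by omega)
      · exact nx _ _ (by omega) (by omega) _ (by omega)
    · exact pt_far T _ _ (by omega) (by omega) _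
  · intro i t hi ht hp
    rcases Nat.mod_two_eq_zero_or_one (i / 2) with hq | hq
    · exact nx _ _ (by omega) (by omega) _ (by omega)
    · exact nx' _ _ (by omega) (by omega) _ (by omega)
  · intro i t hi ht hp
    omega
  · intro i t hi ht hp
    exact pt_far T _ _ (by omega) (by omega) _
  · intro i t hi ht hp
    omega
  · intro i j s t hij hj hs ht l
    exact pt_far T _ _ (by omega) (by omega) l

/-- All cases together. -/
theorem stair_all {n : ℕ} {π : Equiv.Perm (Fin n)} {x : ℕ → ℕ → Fin n} (k b : ℕ)
    (hk : 0 < k) (hb : 0 < b)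
    (T : Tri π ((1 + k * (b + 1) / 2 + b + 1) / 2) x) :
    ∃ σ : PermSig, IsGenericStaircase k b σ ∧ Involves σ ⟨n, π⟩ := by
  rcases Nat.lt_or_ge k 2 with hk2 | hk2
  · have : k = 1 := by omega
    subst this
    exact stair_one T b (by omega)
  rcases Nat.lt_or_ge b 3 with hb3 | hb3
  · interval_cases b
    · exact stair_unit T k (by omega)
    · exact stair_two T k (by omega)
  · apply stair_gen T
    obtain ⟨p, rfl⟩ := Nat.exists_eq_add_of_le hk2
    obtain ⟨q, rfl⟩ := Nat.exists_eq_add_of_le hb3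
    have : (2 + p) * (3 + q + 1) = 8 + 2 * q + 4 * p + p * q := by ring
    rw [this]
    generalize p * q = r
    omega

end StairProof

/-- For positive integers `k` and `b` there is a positive integer `B` (one may
take `B = 1 + k(b+1)/2 + b`) such that every `π ∈ I₂` either contains the
`(k,b)`-generic staircase, or is a `B`-bounded merge of two permutations, the
first part containing all elements preceding the minimum element of `π` and the
second part containing all elements smaller than the first element of `π`. -/
theorem staircase_or_bounded_merge (k b : ℕ) (hk : 0 < k) (hb : 0 < b) :
    ∃ B : ℕ, 0 < B ∧ B = 1 + k * (b + 1) / 2 + b ∧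
      ∀ π : PermSig, π ∈ IkClass 2 →
        (∃ σ : PermSig, IsGenericStaircase k b σ ∧ Involves σ π) ∨
        (∃ (a c : ℕ) (lam : Equiv.Perm (Fin a)) (bet : Equiv.Perm (Fin c))
            (f : Fin a → Fin π.1) (g : Fin c → Fin π.1),
          IsMergeVia lam bet π.2 f g ∧
          typeChanges π.2 (Set.range f) ≤ B ∧
          (∀ x z : Fin π.1, (∀ y, π.2 x ≤ π.2 y) → z < x → ∃ i, f i = z) ∧
          (∀ x z : Fin π.1, (∀ y, x ≤ y) → π.2 z < π.2 x → ∃ j, g j = z)) := by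
  refine ⟨1 + k * (b + 1) / 2 + b, by omega, rfl, ?_⟩
  rintro ⟨n, π⟩ hπ
  have hp : StairProof.No321 π := by
    intro x y z hxy hyz h1 h2
    apply hπ
    refine ⟨![x, y, z], ?_, ?_⟩
    · intro i j hij
      fin_cases i <;> fin_cases j <;> simp at hij ⊢ <;>
        first | exact hxy | exact hyz | exact hxy.trans hyz
    · intro i j hij
      fin_cases i <;> fin_cases j <;> simp at hij ⊢ <;>
        first | exact h1 | exact h2 | exact h2.trans h1
  rcases Nat.eq_zero_or_pos n with hn | hn
  · subst hn
    right
    refine ⟨0, 0, 1, 1, id, id, ⟨⟨strictMono_id, ?_⟩, ⟨strictMono_id, ?_⟩, ?_⟩, ?_, ?_, ?_⟩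
    · intro i; exact i.elim0
    · intro i; exact i.elim0
    · intro i; exact i.elim0
    · have : ∀ S : Set (Fin 0), posChanges S = 0 := by
        intro S
        unfold posChanges
        exact (congrArg Set.ncard (Set.eq_empty_of_isEmpty _)).trans (Set.ncard_empty _)
      unfold typeChanges
      simp only [this]
      omega
    · intro i; exact i.elim0
    · intro i; exact i.elim0
  · by_cases hg : StairProof.Good π (2 * ((1 + k * (b + 1) / 2 + b + 1) / 2) - 1)
        (StairProof.DX π 0)
    · right
      exact StairProof.merge_of_good (hg.mono (by omega))
    · left
      obtain ⟨x, T⟩ := StairProof.exists_tri hp ⟨0, hn⟩ _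
        (StairProof.crossing hp ⟨0, hn⟩ (fun y => Nat.zero_le _) _ hg)
      exact StairProof.stair_all k b hk hb T
end
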